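/- arXiv:0906.2330 — 4 statements merged into one kernel-verified Lean document; each statement's English description precedes it below -/
import Mathlib

section
/- (Newton's identity for Yangian elementary symmetric functions.) For every m ≥ 1 and every u ∈ ℂ, one has Σ_{k=0}^{m−1} (−1)^{m−k−1} e_k(u) * p⁻_{m−k}(u−k) = m • e_m(u) in the algebra A. -/
/-- Matrices in the `k`-leg model over `A`: square matrices indexed by functions
`Fin k → Fin n`, a model of `End((ℂ^n)^⊗k) ⊗ A`. -/
abbrev LegMatrix (n k : ℕ) (A : Type*) := Matrix (Fin k → Fin n) (Fin k → Fin n) A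

variable {n : ℕ} {A : Type*} [Ring A] [Algebra ℂ A]

/-- `T_s(v)`: the generating matrix `T(v)` placed on leg `s` of the `k`-leg model. -/
def Tleg (T : ℂ → Matrix (Fin n) (Fin n) A) {k : ℕ} (s : Fin k) (v : ℂ) :
    LegMatrix n k A := fun f g =>
  if ∀ t : Fin k, t ≠ s → f t = g t then T v (f s) (g s) else 0

/-- The permutation matrix `P_σ` of a permutation `σ` of the legs:
its `(f,g)`-entry is `1` (via `algebraMap ℂ A`) if `f = g ∘ σ` and `0` otherwise. -/
def Pleg (n : ℕ) (A : Type*) [Ring A] [Algebra ℂ A] {k : ℕ} (σ : Equiv.Perm (Fin k)) :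
    LegMatrix n k A := fun f g => if f = g ∘ σ then algebraMap ℂ A 1 else 0

/-- The transposition of legs with 1-based labels `i`, `j` (identity if out of range;
all uses are in range). -/
def legSwap (k i j : ℕ) : Equiv.Perm (Fin k) :=
  if h : 1 ≤ i ∧ i ≤ k ∧ 1 ≤ j ∧ j ≤ k then
    Equiv.swap ⟨i - 1, by omega⟩ ⟨j - 1, by omega⟩ else 1

/-- The antisymmetrizer `A_k = (1/k!) • Σ_σ sgn(σ) • P_σ` in the `k`-leg model. -/
noncomputable def Aleg (n : ℕ) (A : Type*) [Ring A] [Algebra ℂ A] (k : ℕ) :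
    LegMatrix n k A :=
  ((k.factorial : ℂ))⁻¹ •
    ∑ σ : Equiv.Perm (Fin k), ((Equiv.Perm.sign σ : ℤ) : ℂ) • Pleg n A σ

/-- The symmetrizer `S_k = (1/k!) • Σ_σ P_σ` in the `k`-leg model. -/
noncomputable def Sleg (n : ℕ) (A : Type*) [Ring A] [Algebra ℂ A] (k : ℕ) :
    LegMatrix n k A :=
  ((k.factorial : ℂ))⁻¹ • ∑ σ : Equiv.Perm (Fin k), Pleg n A σ

/-- The ordered product `T_1(u) * T_2(u+d) * ⋯ * T_k(u+(k−1)d)` in the `k`-leg model. -/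
noncomputable def TT (T : ℂ → Matrix (Fin n) (Fin n) A) (k : ℕ) (u d : ℂ) :
    LegMatrix n k A :=
  ((List.finRange k).map (fun s => Tleg T s (u + d * ((s : ℕ) : ℂ)))).prod

/-- The RTT relation of the Yangian of `gl_n`:
`((u−v) • 1 − P_{1,2}) T_1(u) T_2(v) = T_2(v) T_1(u) ((u−v) • 1 − P_{1,2})`
in the 2-leg model. -/
def RTT (T : ℂ → Matrix (Fin n) (Fin n) A) : Prop :=
  ∀ u v : ℂ,
    ((u - v) • (1 : LegMatrix n 2 A) - Pleg n A (legSwap 2 1 2)) *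
        Tleg T (0 : Fin 2) u * Tleg T (1 : Fin 2) v =
      Tleg T (1 : Fin 2) v * Tleg T (0 : Fin 2) u *
        ((u - v) • (1 : LegMatrix n 2 A) - Pleg n A (legSwap 2 1 2))

/-- The elementary symmetric function
`e_k(u) = trace(A_k * T_1(u) * T_2(u−1) * ⋯ * T_k(u−k+1))`; for `k = 0` this is `1`. -/
noncomputable def esym (T : ℂ → Matrix (Fin n) (Fin n) A) (k : ℕ) (u : ℂ) : A :=
  Matrix.trace (Aleg n A k * TT T k u (-1))

/-- The homogeneous symmetric function
`h_k(u) = trace(S_k * T_1(u) * T_2(u+1) * ⋯ * T_k(u+k−1))`; for `k = 0` this is `1`. -/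
noncomputable def hsym (T : ℂ → Matrix (Fin n) (Fin n) A) (k : ℕ) (u : ℂ) : A :=
  Matrix.trace (Sleg n A k * TT T k u 1)

/-- The power sum `p⁻_k(u) = trace(T(u) * T(u−1) * ⋯ * T(u−k+1))`,
an ordinary product of `n×n` matrices over `A`. -/
noncomputable def pminus (T : ℂ → Matrix (Fin n) (Fin n) A) (k : ℕ) (u : ℂ) : A :=
  Matrix.trace (((List.finRange k).map (fun i => T (u - ((i : ℕ) : ℂ)))).prod)

/-- The power sum `p⁺_k(u) = trace(T(u) * T(u+1) * ⋯ * T(u+k−1))`,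
an ordinary product of `n×n` matrices over `A`. -/
noncomputable def pplus (T : ℂ → Matrix (Fin n) (Fin n) A) (k : ℕ) (u : ℂ) : A :=
  Matrix.trace (((List.finRange k).map (fun i => T (u + ((i : ℕ) : ℂ)))).prod)

/-- The ordered product of the entries `(M s) (a s) (b s)` over all legs `s`. -/
def legProd {R : Type*} [Ring R] {k : ℕ} (M : Fin k → Matrix (Fin n) (Fin n) R)
    (a b : Fin k → Fin n) : R :=
  (List.ofFn fun s => M s (a s) (b s)).prod

theorem legProd_succ {R : Type*} [Ring R] {k : ℕ} (M : Fin (k + 1) → Matrix (Fin n) (Fin n) R)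
    (a b : Fin (k + 1) → Fin n) :
    legProd M a b = M 0 (a 0) (b 0) *
      legProd (fun s : Fin k => M s.succ) (fun s => a s.succ) (fun s => b s.succ) := by
  simp [legProd, List.ofFn_succ]

theorem legProd_succ_last {R : Type*} [Ring R] {k : ℕ} (M : Fin (k + 1) → Matrix (Fin n) (Fin n) R)
    (a b : Fin (k + 1) → Fin n) :
    legProd M a b =
      legProd (fun s : Fin k => M s.castSucc) (fun s => a s.castSucc) (fun s => b s.castSucc) *
        M (Fin.last k) (a (Fin.last k)) (b (Fin.last k)) := by
  rw [legProd, List.ofFn_succ', List.prod_concat]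
  rfl

/-- A product of one-leg matrices over distinct legs has product entries. -/
theorem prod_Tleg_apply {R : Type*} [Ring R] (T : ℂ → Matrix (Fin n) (Fin n) R) {k : ℕ} (v : Fin k → ℂ)
    (l : List (Fin k)) (hl : l.Nodup) (f g : Fin k → Fin n) :
    (l.map fun s => Tleg T s (v s)).prod f g =
      if ∀ t, t ∉ l → f t = g t then (l.map fun s => T (v s) (f s) (g s)).prod else 0 := by
  induction l generalizing f with
  | nil => simp [Matrix.one_apply, funext_iff]
  | cons s l ih =>
    obtain ⟨hs, hl⟩ := List.nodup_cons.1 hl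
    rw [List.map_cons, List.prod_cons, Matrix.mul_apply,
      Finset.sum_eq_single (Function.update f s (g s))]
    · have hmap : (l.map fun t => T (v t) (Function.update f s (g s) t) (g t)) =
          l.map fun t => T (v t) (f t) (g t) := by
        refine List.map_congr_left fun t ht => ?_
        rw [Function.update_of_ne (by rintro rfl; exact hs ht)]
      have hiff : (∀ t, t ∉ l → Function.update f s (g s) t = g t) ↔
          ∀ t, t ∉ s :: l → f t = g t := by
        constructor
        · intro h t ht
          rw [List.mem_cons, not_or] at ht
          simpa [Function.update_of_ne ht.1] using h t ht.2
        · intro h t ht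
          by_cases hts : t = s
          · subst hts; simp
          · rw [Function.update_of_ne hts]
            exact h t (by simp [hts, ht])
      have hT : Tleg T s (v s) f (Function.update f s (g s)) = T (v s) (f s) (g s) := by
        simp +contextual [Tleg]
      rw [ih hl, hmap, hT]
      simp only [hiff, List.map_cons, List.prod_cons, mul_ite, mul_zero]
    · intro h _ hne
      rw [ih hl]
      unfold Tleg
      split_ifs with h1 h2 <;> try simp
      refine absurd (funext fun t => ?_) hne
      by_cases hts : t = s
      · subst hts; simpa using h2 t hs
      · rw [Function.update_of_ne hts, h1 t hts]
    · simp

theorem TT_apply {R : Type*} [Ring R] (T : ℂ → Matrix (Fin n) (Fin n) R) (k : ℕ) (u d : ℂ) (f g : Fin k → Fin n) :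
    TT T k u d f g = legProd (fun s : Fin k => T (u + d * ((s : ℕ) : ℂ))) f g := by
  rw [TT, prod_Tleg_apply T (fun s : Fin k => u + d * ((s : ℕ) : ℂ)) _ (List.nodup_finRange k)]
  simp [legProd, List.ofFn_eq_map]

theorem Pleg_mul_apply {k : ℕ} (σ : Equiv.Perm (Fin k)) (M : LegMatrix n k A)
    (f g : Fin k → Fin n) : (Pleg n A σ * M) f g = M (f ∘ ⇑σ⁻¹) g := by
  rw [Matrix.mul_apply, Finset.sum_eq_single (f ∘ ⇑σ⁻¹)]
  · have : f = (f ∘ ⇑σ⁻¹) ∘ ⇑σ := by ext; simp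
    rw [Pleg, if_pos this, map_one, one_mul]
  · intro h _ hne
    have : f ≠ h ∘ ⇑σ := by rintro rfl; exact hne (by ext; simp)
    simp [Pleg, this]
  · simp

theorem mul_Pleg_apply {k : ℕ} (σ : Equiv.Perm (Fin k)) (M : LegMatrix n k A)
    (f g : Fin k → Fin n) : (M * Pleg n A σ) f g = M f (g ∘ ⇑σ) := by
  simp [Matrix.mul_apply, Pleg]

/-- Two matrices over a noncommutative ring satisfy `ExchangeRel` when the column
symmetrization of their entrywise products is symmetric in the rows. -/
def ExchangeRel {R : Type*} [Ring R] (M N : Matrix (Fin n) (Fin n) R) : Prop :=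
  ∀ a b c d, M a c * N b d + M a d * N b c = M b c * N a d + M b d * N a c

theorem RTT.exchangeRel {T : ℂ → Matrix (Fin n) (Fin n) A} (hT : RTT T) (u : ℂ) :
    ExchangeRel (T u) (T (u - 1)) := by
  intro a b c d
  have hswap : legSwap 2 1 2 = Equiv.swap (0 : Fin 2) 1 := by simp [legSwap]
  have h := hT u (u - 1)
  rw [hswap] at h
  set P := Pleg n A (Equiv.swap (0 : Fin 2) 1) with hP
  have hPP : P * P = 1 := by
    ext f g
    rw [hP, mul_Pleg_apply]
    simp [Pleg, Matrix.one_apply, Function.comp_assoc, ← Equiv.Perm.coe_mul]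
  have hprod : ∀ f g : Fin 2 → Fin n, (Tleg T (0 : Fin 2) u * Tleg T (1 : Fin 2) (u - 1)) f g =
      T u (f 0) (g 0) * T (u - 1) (f 1) (g 1) := by
    intro f g
    have := prod_Tleg_apply T ![u, u - 1] [0, 1] (by simp) f g
    simpa [Fin.forall_fin_two] using this
  have h0 : (1 - P) * (Tleg T (0 : Fin 2) u * Tleg T (1 : Fin 2) (u - 1)) * (1 + P) = 0 := by
    have hz : (1 - P) * (1 + P) = 0 := by
      rw [sub_mul, mul_add, mul_add, hPP, one_mul, mul_one, one_mul, add_comm, sub_self]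
    rw [sub_sub_cancel, one_smul] at h
    rw [← mul_assoc, h, mul_assoc, hz, mul_zero]
  have h1 := congrFun (congrFun h0 ![a, b]) ![c, d]
  rw [mul_add, mul_one, sub_mul, one_mul, Matrix.add_apply, hP, mul_Pleg_apply,
    Matrix.sub_apply, Matrix.sub_apply, Pleg_mul_apply, Pleg_mul_apply] at h1
  simp only [hprod] at h1
  simp at h1
  rw [← sub_eq_zero, ← h1]
  abel

theorem legProd_exchange {R : Type*} [Ring R] {k : ℕ} (M : Fin (k + 1) → Matrix (Fin n) (Fin n) R) (i : Fin k)
    (hM : ExchangeRel (M i.castSucc) (M i.succ)) (a b : Fin (k + 1) → Fin n) :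
    legProd M a b + legProd M a (b ∘ ⇑(Equiv.swap i.castSucc i.succ)) =
      legProd M (a ∘ ⇑(Equiv.swap i.castSucc i.succ)) b +
        legProd M (a ∘ ⇑(Equiv.swap i.castSucc i.succ))
          (b ∘ ⇑(Equiv.swap i.castSucc i.succ)) := by
  induction k with
  | zero => exact i.elim0
  | succ k ih =>
    refine Fin.cases ?_ (fun i hM => ?_) i hM
    · intro hM
      have hfix : ∀ s : Fin k, Equiv.swap (0 : Fin (k + 2)) 1 s.succ.succ = s.succ.succ :=
        fun s => Equiv.swap_apply_of_ne_of_ne (Fin.succ_ne_zero _)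
          (fun h => Fin.succ_ne_zero s (Fin.succ_injective _ h))
      have hM' : ExchangeRel (M 0) (M 1) := hM
      simp only [legProd_succ, Function.comp_apply, Fin.castSucc_zero, Fin.succ_zero_eq_one,
        Equiv.swap_apply_left, Equiv.swap_apply_right, hfix, ← mul_assoc, ← add_mul]
      rw [hM']
    · have h0 : Equiv.swap i.succ.castSucc i.succ.succ 0 = 0 :=
        Equiv.swap_apply_of_ne_of_ne (by simp [Fin.ext_iff]) (by simp [Fin.ext_iff])
      have hs : ∀ s : Fin (k + 1), Equiv.swap i.succ.castSucc i.succ.succ s.succ =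
          (Equiv.swap i.castSucc i.succ s).succ := fun s => by
        rw [Fin.castSucc_succ]
        exact (Fin.succ_injective _).swap_apply _ _ _
      have := ih (fun s => M s.succ) i hM (fun s => a s.succ) (fun s => b s.succ)
      simp only [legProd_succ M, Function.comp_apply, h0, hs, ← mul_add]
      congr 1

/-- The row antisymmetrization of `legProd`. -/
def rowAlt {R : Type*} [Ring R] {k : ℕ} (M : Fin k → Matrix (Fin n) (Fin n) R)
    (a b : Fin k → Fin n) : R :=
  ∑ σ : Equiv.Perm (Fin k), Equiv.Perm.sign σ • legProd M (a ∘ ⇑σ) b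

theorem rowAlt_comp_left {R : Type*} [Ring R] {k : ℕ} (M : Fin k → Matrix (Fin n) (Fin n) R)
    (a b : Fin k → Fin n) (τ : Equiv.Perm (Fin k)) :
    rowAlt M (a ∘ ⇑τ) b = Equiv.Perm.sign τ • rowAlt M a b := by
  unfold rowAlt
  rw [← Equiv.sum_comp (Equiv.mulLeft τ) fun σ => Equiv.Perm.sign σ • legProd M (a ∘ ⇑σ) b,
    Finset.smul_sum]
  refine Finset.sum_congr rfl fun σ _ => ?_
  simp only [Equiv.coe_mulLeft, Equiv.Perm.sign_mul, smul_smul, Equiv.Perm.coe_mul,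
    Function.comp_assoc, ← mul_assoc, Int.units_mul_self, one_mul]

theorem rowAlt_comp_swap {k : ℕ} (M : Fin (k + 1) → Matrix (Fin n) (Fin n) A) (i : Fin k)
    (hM : ExchangeRel (M i.castSucc) (M i.succ)) (a b : Fin (k + 1) → Fin n) :
    rowAlt M a (b ∘ ⇑(Equiv.swap i.castSucc i.succ)) = - rowAlt M a b := by
  set s := Equiv.swap i.castSucc i.succ
  have hsign : Equiv.Perm.sign s = -1 := Equiv.Perm.sign_swap (Fin.castSucc_lt_succ).ne
  have hflip : ∀ c, ∑ σ : Equiv.Perm (Fin (k + 1)),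
      Equiv.Perm.sign σ • legProd M ((a ∘ ⇑σ) ∘ ⇑s) c = - rowAlt M a c := fun c => by
    rw [rowAlt, ← Equiv.sum_comp (Equiv.mulRight s)
      fun σ => Equiv.Perm.sign σ • legProd M (a ∘ ⇑σ) c, ← Finset.sum_neg_distrib]
    refine Finset.sum_congr rfl fun σ _ => ?_
    simp [Equiv.Perm.sign_mul, hsign, Function.comp_assoc]
  have key : rowAlt M a b + rowAlt M a (b ∘ ⇑s) = - rowAlt M a b + - rowAlt M a (b ∘ ⇑s) := by
    rw [← hflip b, ← hflip (b ∘ ⇑s)]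
    simp only [rowAlt, ← Finset.sum_add_distrib, ← smul_add]
    exact Finset.sum_congr rfl fun σ _ => by rw [legProd_exchange M i hM]
  have h2 : (2 : ℂ) • (rowAlt M a b + rowAlt M a (b ∘ ⇑s)) = 0 := by
    rw [two_smul]
    nth_rewrite 1 [key]
    abel
  have h3 := (smul_eq_zero_iff_right (two_ne_zero : (2 : ℂ) ≠ 0)).1 h2
  exact eq_neg_of_add_eq_zero_right h3

theorem rowAlt_comp_right {k : ℕ} (M : Fin (k + 1) → Matrix (Fin n) (Fin n) A)
    (hM : ∀ i : Fin k, ExchangeRel (M i.castSucc) (M i.succ)) (a b : Fin (k + 1) → Fin n)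
    (τ : Equiv.Perm (Fin (k + 1))) :
    rowAlt M a (b ∘ ⇑τ) = Equiv.Perm.sign τ • rowAlt M a b := by
  have hτ : τ ∈ Submonoid.closure
      (Set.range fun i : Fin k => Equiv.swap i.castSucc i.succ) := by
    rw [Equiv.Perm.mclosure_swap_castSucc_succ]; trivial
  induction hτ using Submonoid.closure_induction generalizing b with
  | mem x hx =>
    obtain ⟨i, rfl⟩ := hx
    rw [rowAlt_comp_swap M i (hM i), Equiv.Perm.sign_swap (Fin.castSucc_lt_succ).ne]
    simp
  | one => simp
  | mul x y _ _ hx hy =>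
    rw [Equiv.Perm.coe_mul, ← Function.comp_assoc, hy, hx, smul_smul, Equiv.Perm.sign_mul,
      mul_comm]

theorem sum_perm_snoc {α R : Type*} [Ring R] {k : ℕ} (F : (Fin (k + 1) → α) → R)
    (f : Fin k → α) (c : α) :
    ∑ σ : Equiv.Perm (Fin (k + 1)),
        Equiv.Perm.sign σ • F ((Fin.snoc f c : Fin (k + 1) → α) ∘ ⇑σ) =
      ∑ τ : Equiv.Perm (Fin k), Equiv.Perm.sign τ • F (Fin.snoc (f ∘ ⇑τ) c) -
        ∑ i : Fin k, ∑ τ : Equiv.Perm (Fin k),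
          Equiv.Perm.sign τ • F (Fin.snoc (Function.update f i c ∘ ⇑τ) (f i)) := by
  let e : Equiv.Perm (Fin (k + 1)) ≃ Option (Fin k) × Equiv.Perm (Fin k) :=
    (Equiv.permCongr finSuccEquivLast).trans Equiv.Perm.decomposeOption
  have hsign : ∀ p, Equiv.Perm.sign (e.symm p) =
      Equiv.Perm.sign (Equiv.swap none p.1) * Equiv.Perm.sign p.2 := fun p => by
    simp [e, Equiv.permCongr_symm]
  have happly : ∀ p s, e.symm p s = finSuccEquivLast.symm
      (Equiv.swap none p.1 ((finSuccEquivLast s).map p.2)) := fun p s => by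
    simp [e, Equiv.permCongr_symm]
  rw [← e.symm.sum_comp, Fintype.sum_prod_type, Fintype.sum_option, sub_eq_add_neg,
    ← Finset.sum_neg_distrib]
  congr 1
  · refine Finset.sum_congr rfl fun τ _ => ?_
    rw [hsign]
    congr 1
    · simp
    · congr 1
      ext s
      refine Fin.lastCases ?_ (fun s => ?_) s <;> simp [happly]
  · refine Finset.sum_congr rfl fun i _ => ?_
    rw [← Finset.sum_neg_distrib]
    refine Finset.sum_congr rfl fun τ _ => ?_
    rw [hsign, Equiv.Perm.sign_swap (Option.some_ne_none i).symm, neg_one_mul, Units.neg_smul]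
    congr 3
    ext s
    refine Fin.lastCases ?_ (fun s => ?_) s
    · simp [happly]
    · by_cases hs : τ s = i
      · simp [happly, hs]
      · have : Equiv.swap none (some i) (some (τ s)) = some (τ s) :=
          Equiv.swap_apply_of_ne_of_ne (by simp) (by simpa using hs)
        simp [happly, this, hs]

theorem legProd_snoc {R : Type*} [Ring R] {k : ℕ}
    (M : Fin (k + 1) → Matrix (Fin n) (Fin n) R) (a b : Fin k → Fin n) (c d : Fin n) :
    legProd M (Fin.snoc a c) (Fin.snoc b d) =
      legProd (fun s : Fin k => M s.castSucc) a b * M (Fin.last k) c d := by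
  simp [legProd_succ_last]

/-- The trace of the row antisymmetrization of `M` multiplied by `X` on the last leg. -/
def altTrace {R : Type*} [Ring R] {k : ℕ} (M : Fin (k + 1) → Matrix (Fin n) (Fin n) R)
    (X : Matrix (Fin n) (Fin n) R) : R :=
  ∑ f : Fin k → Fin n, ∑ c, ∑ d, rowAlt M (Fin.snoc f c) (Fin.snoc f d) * X d c

theorem sum_snoc {R : Type*} [Ring R] {k : ℕ} (F : (Fin (k + 1) → Fin n) → R) :
    ∑ f, F f = ∑ f : Fin k → Fin n, ∑ c, F (Fin.snoc f c) := by
  rw [← (Fin.snocEquiv fun _ : Fin (k + 1) => Fin n).sum_comp, Fintype.sum_prod_type,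
    Finset.sum_comm]
  rfl

theorem altTrace_one {R : Type*} [Ring R] {k : ℕ}
    (M : Fin (k + 1) → Matrix (Fin n) (Fin n) R) :
    altTrace M 1 = ∑ f, rowAlt M f f := by
  simp [altTrace, sum_snoc, Matrix.one_apply]

theorem sum_rowAlt_update {k : ℕ} (M : Fin (k + 1) → Matrix (Fin n) (Fin n) A)
    (hM : ∀ i : Fin k, ExchangeRel (M i.castSucc) (M i.succ)) (X : Matrix (Fin n) (Fin n) A)
    (i : Fin (k + 1)) :
    ∑ f, ∑ c, rowAlt M (Function.update f i c) f * X (f i) c = altTrace M X := by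
  set s := Equiv.swap i (Fin.last k) with hs
  have hreindex : ∑ f, ∑ c, rowAlt M (Function.update f i c) f * X (f i) c =
      ∑ f, ∑ c, rowAlt M (Function.update f (Fin.last k) c) f * X (f (Fin.last k)) c := by
    rw [← (Equiv.arrowCongr s (Equiv.refl (Fin n))).sum_comp]
    refine Finset.sum_congr rfl fun f _ => Finset.sum_congr rfl fun c _ => ?_
    have hf : Equiv.arrowCongr s (Equiv.refl (Fin n)) f = f ∘ ⇑s := by
      ext t; simp [hs]
    have hu : Function.update (f ∘ ⇑s) i c = Function.update f (Fin.last k) c ∘ ⇑s := by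
      have : i = s.symm (Fin.last k) := by simp [hs]
      rw [Function.update_comp_equiv, ← this]
    rw [hf, hu, rowAlt_comp_left, rowAlt_comp_right M hM, smul_smul, Int.units_mul_self, one_smul]
    simp [hs]
  rw [hreindex, sum_snoc, altTrace]
  refine Finset.sum_congr rfl fun f _ => ?_
  rw [Finset.sum_comm]
  have hu : ∀ c d, Function.update (Fin.snoc f d : Fin (k + 1) → Fin n) (Fin.last k) c =
      Fin.snoc f c := fun c d => Fin.update_snoc_last ..
  simp only [hu, Fin.snoc_last]

/-- Expansion of `altTrace` along the last leg. -/
theorem altTrace_expand {R : Type*} [Ring R] {k : ℕ}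
    (M : Fin (k + 1) → Matrix (Fin n) (Fin n) R) (X : Matrix (Fin n) (Fin n) R) :
    altTrace M X =
      (∑ f, rowAlt (fun s : Fin k => M s.castSucc) f f) * (M (Fin.last k) * X).trace -
        ∑ i : Fin k, ∑ f, ∑ c, rowAlt (fun s : Fin k => M s.castSucc) (Function.update f i c) f *
          (M (Fin.last k) * X) (f i) c := by
  have hrow : ∀ (f : Fin k → Fin n) (c d : Fin n), rowAlt M (Fin.snoc f c) (Fin.snoc f d) =
      rowAlt (fun s : Fin k => M s.castSucc) f f * M (Fin.last k) c d -
        ∑ i : Fin k, rowAlt (fun s : Fin k => M s.castSucc) (Function.update f i c) f *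
          M (Fin.last k) (f i) d := fun f c d => by
    rw [rowAlt, sum_perm_snoc fun a => legProd M a (Fin.snoc f d)]
    simp only [legProd_snoc, rowAlt, Finset.sum_mul, smul_mul_assoc]
  simp only [altTrace, hrow, sub_mul, Finset.sum_sub_distrib]
  congr 1
  · simp only [Matrix.trace, Matrix.diag_apply, Matrix.mul_apply, Finset.sum_mul, mul_assoc]
    simp only [Finset.mul_sum]
  · refine Eq.symm (Finset.sum_comm.trans (Finset.sum_congr rfl fun f _ =>
      Finset.sum_comm.trans (Finset.sum_congr rfl fun c _ => ?_)))
    simp only [Matrix.mul_apply, Finset.sum_mul, Finset.mul_sum, mul_assoc]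
    rw [Finset.sum_comm]

theorem esym_eq (T : ℂ → Matrix (Fin n) (Fin n) A) (k : ℕ) (u : ℂ) :
    ∑ f, rowAlt (fun s : Fin k => T (u - ((s : ℕ) : ℂ))) f f =
      (k.factorial : ℂ) • esym T k u := by
  have hk : (k.factorial : ℂ) ≠ 0 := by exact_mod_cast k.factorial_ne_zero
  rw [esym, Aleg, smul_mul_assoc, Matrix.trace_smul, smul_smul, mul_inv_cancel₀ hk, one_smul,
    Finset.sum_mul, Matrix.trace_sum]
  simp only [rowAlt]
  rw [Finset.sum_comm, ← Equiv.sum_comp (Equiv.inv (Equiv.Perm (Fin k)))]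
  refine Finset.sum_congr rfl fun σ _ => ?_
  have htrace : (Pleg n A σ * TT T k u (-1)).trace =
      ∑ f, legProd (fun s : Fin k => T (u - ((s : ℕ) : ℂ))) (f ∘ ⇑σ⁻¹) f := by
    simp only [Matrix.trace, Matrix.diag_apply, Pleg_mul_apply, TT_apply, neg_one_mul,
      ← sub_eq_add_neg]
  rw [smul_mul_assoc, Matrix.trace_smul, htrace, ← Finset.smul_sum, Equiv.inv_apply,
    Equiv.Perm.sign_inv]
  rcases Int.units_eq_one_or (Equiv.Perm.sign σ) with h | h <;> simp [h]

/-- The product `T(v) * T(v−1) * ⋯ * T(v−j+1)`. -/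
noncomputable def stringProd {R : Type*} [Ring R] (T : ℂ → Matrix (Fin n) (Fin n) R)
    (j : ℕ) (v : ℂ) : Matrix (Fin n) (Fin n) R :=
  ((List.range j).map fun i : ℕ => T (v - (i : ℂ))).prod

theorem stringProd_succ {R : Type*} [Ring R] (T : ℂ → Matrix (Fin n) (Fin n) R)
    (j : ℕ) (v : ℂ) : stringProd T (j + 1) v = T v * stringProd T j (v - 1) := by
  simp [stringProd, List.range_succ_eq_map, Function.comp_def, sub_sub, add_comm]

theorem pminus_eq {R : Type*} [Ring R] (T : ℂ → Matrix (Fin n) (Fin n) R) (j : ℕ) (v : ℂ) :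
    pminus T j v = (stringProd T j v).trace := by
  have : (List.finRange j).flatMap (fun i : Fin j => [(i : ℕ)]) = List.range j :=
    (List.flatMap_pure_eq_map _ _).trans List.map_coe_finRange_eq_range
  simp [pminus, stringProd, this]

theorem altTrace_stringProd {T : ℂ → Matrix (Fin n) (Fin n) A} (hT : RTT T) (u : ℂ) (k j : ℕ) :
    altTrace (fun s : Fin (k + 1) => T (u - ((s : ℕ) : ℂ))) (stringProd T j (u - k - 1)) =
      (k.factorial : ℂ) • ∑ i ∈ Finset.range (k + 1),
        ((-1 : ℂ) ^ (k - i)) • (esym T i u * pminus T (j + (k + 1 - i)) (u - (i : ℂ))) := by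
  induction k generalizing j with
  | zero =>
    have := esym_eq T 0 u
    rw [altTrace_expand]
    simp only [Fin.val_castSucc, this]
    simp [← stringProd_succ, pminus_eq]
  | succ k ih =>
    have hM : ∀ i : Fin k, ExchangeRel (T (u - ((i.castSucc : ℕ) : ℂ)))
        (T (u - ((i.succ : ℕ) : ℂ))) := fun i => by
      simpa [sub_sub] using hT.exchangeRel (u - ((i : ℕ) : ℂ))
    have hstring : T (u - ((k + 1 : ℕ) : ℂ)) * stringProd T j (u - ((k + 1 : ℕ) : ℂ) - 1) =
        stringProd T (j + 1) (u - k - 1) := by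
      rw [stringProd_succ]; push_cast; simp only [sub_sub]
    rw [altTrace_expand]
    simp only [Fin.val_castSucc, Fin.val_last, hstring,
      sum_rowAlt_update (fun s : Fin (k + 1) => T (u - ((s : ℕ) : ℂ))) hM, esym_eq, ih]
    rw [Finset.sum_range_succ _ (k + 1), smul_add, sub_eq_add_neg, add_comm]
    congr 1
    · rw [Finset.sum_const, Finset.card_univ, Fintype.card_fin, ← Nat.cast_smul_eq_nsmul ℂ,
        smul_smul, ← Nat.cast_mul, ← Nat.factorial_succ, ← smul_neg, ← Finset.sum_neg_distrib]
      congr 1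
      refine Finset.sum_congr rfl fun i hi => ?_
      have hi' : i ≤ k := Nat.lt_succ_iff.1 (Finset.mem_range.1 hi)
      rw [Nat.sub_add_comm hi', pow_succ, mul_neg_one, neg_smul,
        show j + (k + 1 + 1 - i) = j + 1 + (k - i + 1) by omega]
    · simp [pminus_eq, sub_sub]

/-- Newton's identity for Yangian elementary symmetric functions:
`Σ_{k=0}^{m−1} (−1)^{m−k−1} e_k(u) p⁻_{m−k}(u−k) = m • e_m(u)`. -/
theorem newton_esym (hn : 1 ≤ n) (T : ℂ → Matrix (Fin n) (Fin n) A)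
    (hT : RTT T) (m : ℕ) (hm : 1 ≤ m) (u : ℂ) :
    ∑ k ∈ Finset.range m,
        ((-1 : ℂ) ^ (m - k - 1)) • (esym T k u * pminus T (m - k) (u - (k : ℂ))) =
      (m : ℂ) • esym T m u := by
  obtain ⟨k, rfl⟩ : ∃ k, m = k + 1 := ⟨m - 1, by omega⟩
  have hk : (k.factorial : ℂ) ≠ 0 := by exact_mod_cast k.factorial_ne_zero
  have h := altTrace_stringProd hT u k 0
  rw [show stringProd T 0 (u - k - 1) = 1 from rfl, altTrace_one, esym_eq, Nat.factorial_succ,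
    mul_comm, Nat.cast_mul, ← smul_smul] at h
  rw [smul_right_injective A hk h]
  refine Finset.sum_congr rfl fun i _ => ?_
  rw [zero_add, show k + 1 - i - 1 = k - i by omega]
end

section
/- For every m ≥ 1 and every u ∈ ℂ, the shifted symmetric functions satisfy Σ_{k=0}^{m} (−1)^k e*_k(u−k+1) · h*_{m−k}(u−k) = 0 in ℂ. -/
/-- The shifted elementary symmetric function
`e*_k(u) = Σ_{1 ≤ i_1 < ⋯ < i_k ≤ n} (μ_{i_1}+u+k−1)(μ_{i_2}+u+k−2)⋯(μ_{i_k}+u)`,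
the sum over strictly increasing `k`-tuples in `{1,…,n}`
(so `e*_0(u) = 1` and `e*_k(u) = 0` for `k > n`). -/
noncomputable def estar (n : ℕ) (μ : Fin n → ℂ) (k : ℕ) (u : ℂ) : ℂ :=
  ∑ φ ∈ Finset.univ.filter (fun φ : Fin k → Fin n => ∀ i j : Fin k, i < j → φ i < φ j),
    ∏ j : Fin k, (μ (φ j) + u + ((k : ℂ) - 1 - ((j : ℕ) : ℂ)))

/-- The shifted homogeneous symmetric function
`h*_k(u) = Σ_{1 ≤ i_1 ≤ ⋯ ≤ i_k ≤ n} (μ_{i_1}+u−k+1)(μ_{i_2}+u−k+2)⋯(μ_{i_k}+u)`,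
the sum over weakly increasing `k`-tuples in `{1,…,n}` (so `h*_0(u) = 1`). -/
noncomputable def hstar (n : ℕ) (μ : Fin n → ℂ) (k : ℕ) (u : ℂ) : ℂ :=
  ∑ φ ∈ Finset.univ.filter (fun φ : Fin k → Fin n => ∀ i j : Fin k, i ≤ j → φ i ≤ φ j),
    ∏ j : Fin k, (μ (φ j) + u - (k : ℂ) + 1 + ((j : ℕ) : ℂ))

/-- `m_i := μ_i + n − i` (with the 1-based label `i`; here `i : Fin n` is 0-based). -/
noncomputable def mshift (n : ℕ) (μ : Fin n → ℂ) (i : Fin n) : ℂ :=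
  μ i + (n : ℂ) - (((i : ℕ) : ℂ) + 1)

/-- `γ_i := ∏_{j ≠ i} (1 − 1/(m_i − m_j))`. -/
noncomputable def gammaCoef (n : ℕ) (μ : Fin n → ℂ) (i : Fin n) : ℂ :=
  ∏ j ∈ Finset.univ.erase i, (1 - 1 / (mshift n μ i - mshift n μ j))

/-- The shifted power sum `p*_k(u) := Σ_{i=1}^n γ_i (m_i+u)(m_i+u+1)⋯(m_i+u+k−1)`. -/
noncomputable def pstar (n : ℕ) (μ : Fin n → ℂ) (k : ℕ) (u : ℂ) : ℂ :=
  ∑ i : Fin n, gammaCoef n μ i * ∏ t ∈ Finset.range k, (mshift n μ i + u + (t : ℂ))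

/-- The word `w` is strictly increasing on its first `k` letters and weakly decreasing afterwards. -/
def IsHookWord {α : Type*} [LinearOrder α] {m : ℕ} (k : ℕ) (w : Fin m → α) : Prop :=
  (∀ i j : Fin m, i < j → (j : ℕ) < k → w i < w j) ∧
    ∀ i j : Fin m, k ≤ (i : ℕ) → i ≤ j → w j ≤ w i

/-- The word `w` is strictly increasing up to its `k`-th letter (counted from one), and weakly
decreasing from that letter on. -/
def HasPeakAt {α : Type*} [LinearOrder α] {m : ℕ} (k : ℕ) (w : Fin m → α) : Prop :=
  1 ≤ k ∧ k ≤ m ∧ (∀ i j : Fin m, i < j → (j : ℕ) < k → w i < w j) ∧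
    ∀ i j : Fin m, k ≤ (i : ℕ) + 1 → i ≤ j → w j ≤ w i

theorem isHookWord_iff_hasPeakAt {α : Type*} [LinearOrder α] {m : ℕ} (hm : 1 ≤ m) {k : ℕ}
    (hk : k ≤ m) (w : Fin m → α) :
    IsHookWord k w ↔ HasPeakAt k w ∨ HasPeakAt (k + 1) w := by
  constructor
  · rintro ⟨hinc, hdec⟩
    by_cases hpeak : 1 ≤ k ∧ ∀ h : k < m, w ⟨k, h⟩ ≤ w ⟨k - 1, by omega⟩
    · obtain ⟨hk1, hle⟩ := hpeak
      refine Or.inl ⟨hk1, hk, hinc, fun i j hi hij => ?_⟩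
      by_cases hki : k ≤ (i : ℕ)
      · exact hdec i j hki hij
      · rcases hij.eq_or_lt with rfl | hlt
        · exact le_rfl
        · have hj : k ≤ (j : ℕ) := by
            have : (i : ℕ) < j := hlt
            omega
          have hkm : k < m := hj.trans_lt j.isLt
          rw [show i = ⟨k - 1, by omega⟩ from Fin.ext (by simp only; omega)]
          exact (hdec ⟨k, hkm⟩ j le_rfl hj).trans (hle hkm)
    · have hkm : k < m := by
        by_contra hcon
        exact hpeak ⟨by omega, fun h => absurd h hcon⟩
      refine Or.inr ⟨by omega, hkm, fun i j hij hj => ?_,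
        fun i j hi hij => hdec i j (by omega) hij⟩
      by_cases hjk : (j : ℕ) < k
      · exact hinc i j hij hjk
      · have hij' : (i : ℕ) < j := hij
        have hlt : w ⟨k - 1, by omega⟩ < w ⟨k, hkm⟩ := by
          by_contra hcon
          exact hpeak ⟨by omega, fun _ => not_lt.mp hcon⟩
        obtain rfl : j = ⟨k, hkm⟩ := Fin.ext (by simp only; omega)
        rcases eq_or_ne (i : ℕ) (k - 1) with hi | hi
        · rwa [show i = ⟨k - 1, by omega⟩ from Fin.ext hi]
        · simp only at hij'
          exact (hinc i ⟨k - 1, by omega⟩ (Fin.lt_def.mpr (by simp only; omega))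
            (by simp only; omega)).trans hlt
  · rintro (⟨_, _, hinc, hdec⟩ | ⟨_, _, hinc, hdec⟩)
    · exact ⟨hinc, fun i j hi hij => hdec i j (by omega) hij⟩
    · exact ⟨fun i j hij hj => hinc i j hij (by omega), fun i j hi hij => hdec i j (by omega) hij⟩

theorem not_hasPeakAt_and_succ {α : Type*} [LinearOrder α] {m k : ℕ} (w : Fin m → α) :
    ¬ (HasPeakAt k w ∧ HasPeakAt (k + 1) w) := by
  rintro ⟨⟨hk, _, _, hdec⟩, _, hkm, hinc, _⟩
  have hlt := hinc ⟨k - 1, by omega⟩ ⟨k, by omega⟩ (Fin.lt_def.mpr (by simp only; omega))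
    (by simp only; omega)
  exact absurd (hdec ⟨k - 1, by omega⟩ ⟨k, by omega⟩ (by simp only; omega)
    (Fin.le_def.mpr (by simp only; omega))) (not_le.mpr hlt)

open Classical in
theorem sum_neg_one_pow_isHookWord {α : Type*} [LinearOrder α] {R : Type*} [Ring R] {m : ℕ}
    (hm : 1 ≤ m) (w : Fin m → α) :
    ∑ k ∈ Finset.range (m + 1), (if IsHookWord k w then (-1 : R) ^ k else 0) = 0 := by
  let f : ℕ → R := fun k => if HasPeakAt k w then (-1 : R) ^ k else 0
  have hterm : ∀ k ∈ Finset.range (m + 1),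
      (if IsHookWord k w then (-1 : R) ^ k else 0) = f k - f (k + 1) := by
    intro k hk
    have hiff := isHookWord_iff_hasPeakAt hm (Nat.lt_succ_iff.mp (Finset.mem_range.mp hk)) w
    have hnot := not_hasPeakAt_and_succ (k := k) w
    by_cases h₁ : HasPeakAt k w <;> by_cases h₂ : HasPeakAt (k + 1) w <;>
      simp_all [f, pow_succ]
  rw [Finset.sum_congr rfl hterm, Finset.sum_range_sub']
  simp [f, HasPeakAt]

open Classical in
theorem hstar_eq_sum_antitone (n : ℕ) (μ : Fin n → ℂ) (l : ℕ) (v : ℂ) :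
    hstar n μ l v = ∑ φ : Fin l → Fin n,
      if ∀ i j : Fin l, i ≤ j → φ j ≤ φ i then ∏ j : Fin l, (μ (φ j) + v - ((j : ℕ) : ℂ))
      else 0 := by
  rw [hstar, Finset.sum_filter]
  refine Fintype.sum_equiv (Equiv.arrowCongr Fin.revPerm (Equiv.refl _)) _ _ fun φ => ?_
  have hiff : (∀ i j : Fin l, i ≤ j → φ i ≤ φ j) ↔
      ∀ i j : Fin l, i ≤ j → φ j.rev ≤ φ i.rev :=
    ⟨fun h i j hij => h _ _ (Fin.rev_le_rev.mpr hij), fun h i j hij => by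
      simpa using h j.rev i.rev (Fin.rev_le_rev.mpr hij)⟩
  have hprod : ∏ j : Fin l, (μ (φ j) + v - (l : ℂ) + 1 + ((j : ℕ) : ℂ)) =
      ∏ j : Fin l, (μ (φ j.rev) + v - ((j : ℕ) : ℂ)) := by
    refine Fintype.prod_equiv Fin.revPerm _ _ fun j => ?_
    have hj : (((Fin.rev j : Fin l) : ℕ) : ℂ) = (l : ℂ) - ((j : ℕ) + 1) := by
      rw [Fin.val_rev, Nat.cast_sub j.isLt]
      push_cast
      ring
    simp only [Fin.revPerm_apply, Fin.rev_rev, hj]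
    ring
  simp only [hiff, hprod]
  rfl

theorem isHookWord_append_iff {α : Type*} [LinearOrder α] {k l : ℕ} (φ : Fin k → α)
    (ψ : Fin l → α) :
    IsHookWord k (Fin.append φ ψ) ↔
      (∀ i j : Fin k, i < j → φ i < φ j) ∧ ∀ i j : Fin l, i ≤ j → ψ j ≤ ψ i := by
  have hle (i : Fin l) (j : Fin k) : ¬ Fin.natAdd k i ≤ Fin.castAdd l j := by
    simp only [Fin.le_def, Fin.val_natAdd, Fin.val_castAdd]
    omega
  have hlt (i j : Fin k) : Fin.castAdd l i < Fin.castAdd l j ↔ i < j := Iff.rfl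
  have hnlt (i : Fin l) (j : Fin k) : ¬ Fin.natAdd k i < Fin.castAdd l j :=
    fun h => hle i j h.le
  simp [IsHookWord, Fin.forall_fin_add, hle, hlt, hnlt]

open Classical in
theorem estar_mul_hstar_eq_sum (n : ℕ) (μ : Fin n → ℂ) (k l : ℕ) (u : ℂ) :
    estar n μ k (u - (k : ℂ) + 1) * hstar n μ l (u - (k : ℂ)) =
      ∑ w : Fin (k + l) → Fin n,
        if IsHookWord k w then ∏ t, (μ (w t) + u - ((t : ℕ) : ℂ)) else 0 := by
  rw [hstar_eq_sum_antitone, estar, Finset.sum_filter, Finset.sum_mul_sum,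
    ← Fintype.sum_prod_type']
  refine Fintype.sum_equiv (Fin.appendEquiv k l) _ _ fun ⟨φ, ψ⟩ => ?_
  have happ : Fin.appendEquiv k l (φ, ψ) = Fin.append φ ψ := rfl
  have hφ : ∏ j : Fin k, (μ (φ j) + (u - (k : ℂ) + 1) + ((k : ℂ) - 1 - ((j : ℕ) : ℂ))) =
      ∏ j : Fin k, (μ (φ j) + u - ((j : ℕ) : ℂ)) :=
    Finset.prod_congr rfl fun j _ => by ring
  have hψ : ∏ j : Fin l, (μ (ψ j) + (u - (k : ℂ)) - ((j : ℕ) : ℂ)) =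
      ∏ j : Fin l, (μ (ψ j) + u - ((k : ℂ) + ((j : ℕ) : ℂ))) :=
    Finset.prod_congr rfl fun j _ => by ring
  simp only [happ, isHookWord_append_iff, hφ, hψ, Fin.prod_univ_add, Fin.append_left,
    Fin.append_right, Fin.val_castAdd, Fin.val_natAdd, Nat.cast_add, ite_and, ite_mul, mul_ite,
    mul_zero, zero_mul]
  split_ifs <;> rfl

/-- `Σ_{k=0}^{m} (−1)^k e*_k(u−k+1) h*_{m−k}(u−k) = 0` for all `m ≥ 1`. -/
theorem estar_hstar_orthogonality (n : ℕ) (hn : 1 ≤ n) (μ : Fin n → ℂ)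
    (m : ℕ) (hm : 1 ≤ m) (u : ℂ) :
    ∑ k ∈ Finset.range (m + 1),
        (-1 : ℂ) ^ k * estar n μ k (u - (k : ℂ) + 1) * hstar n μ (m - k) (u - (k : ℂ)) =
      0 := by
  classical
  have hterm : ∀ k ∈ Finset.range (m + 1),
      (-1 : ℂ) ^ k * estar n μ k (u - (k : ℂ) + 1) * hstar n μ (m - k) (u - (k : ℂ)) =
        ∑ w : Fin m → Fin n, (if IsHookWord k w then (-1 : ℂ) ^ k else 0) *
          ∏ t, (μ (w t) + u - ((t : ℕ) : ℂ)) := by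
    intro k hk
    obtain ⟨l, rfl⟩ := Nat.exists_eq_add_of_le (Nat.lt_succ_iff.mp (Finset.mem_range.mp hk))
    rw [Nat.add_sub_cancel_left, mul_assoc, estar_mul_hstar_eq_sum, Finset.mul_sum]
    simp only [mul_ite, ite_mul, mul_zero, zero_mul]
  rw [Finset.sum_congr rfl hterm, Finset.sum_comm]
  refine Finset.sum_eq_zero fun w _ => ?_
  rw [← Finset.sum_mul, sum_neg_one_pow_isHookWord hm w, zero_mul]
end

section
/- Assume the numbers m_i := μ_i + n − i (1 ≤ i ≤ n) are pairwise distinct. Then for every k ≥ 1 and every u ∈ ℂ, e*_k(u−k) = Σ over all compositions λ = (λ_1,…,λ_m) of k of ((−1)^{k−m} / (a_1 a_2 ⋯ a_m)) · p*_{λ_1}(u−a_1) · p*_{λ_2}(u−a_2) ⋯ p*_{λ_m}(u−a_m), where a_i := λ_1 + ⋯ + λ_i. -/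
/-- The rising factorial `x (x + 1) ⋯ (x + j - 1)`. -/
noncomputable def risingFactorial (x : ℂ) (j : ℕ) : ℂ :=
  ∏ t ∈ Finset.range j, (x + (t : ℂ))

theorem risingFactorial_zero (x : ℂ) : risingFactorial x 0 = 1 := by
  simp [risingFactorial]

theorem risingFactorial_succ (x : ℂ) (j : ℕ) :
    risingFactorial x (j + 1) = risingFactorial x j * (x + j) := by
  simp [risingFactorial, Finset.prod_range_succ]

theorem risingFactorial_succ_left (x : ℂ) (j : ℕ) :
    risingFactorial x (j + 1) = x * risingFactorial (x + 1) j := by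
  rw [risingFactorial, Finset.prod_range_succ', mul_comm, risingFactorial]
  congr 1
  · simp
  · refine Finset.prod_congr rfl fun t _ => ?_
    push_cast
    ring

/-- The shifted elementary symmetric function of the list of values `m_i = μ_i + n - i`. -/
noncomputable def listEstar : List ℂ → ℂ → ℕ → ℂ
  | _, _, 0 => 1
  | [], _, _ + 1 => 0
  | a :: L, v, k + 1 => listEstar L v (k + 1) + (a + v + k - L.length) * listEstar L v k

theorem listEstar_zero (L : List ℂ) (v : ℂ) : listEstar L v 0 = 1 := by
  cases L <;> rfl

theorem listEstar_cons_succ (a : ℂ) (L : List ℂ) (v : ℂ) (k : ℕ) :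
    listEstar (a :: L) v (k + 1) =
      listEstar L v (k + 1) + (a + v + k - L.length) * listEstar L v k := rfl

theorem listEstar_eq_zero (L : List ℂ) (v : ℂ) :
    ∀ k, L.length < k → listEstar L v k = 0 := by
  induction L with
  | nil =>
    intro k hk
    cases k with
    | zero => simp at hk
    | succ k => rfl
  | cons a L ih =>
    intro k hk
    cases k with
    | zero => simp at hk
    | succ k =>
      rw [List.length_cons] at hk
      rw [listEstar_cons_succ, ih _ (by omega), ih _ (by omega)]
      ring

theorem listEstar_perm {L₁ L₂ : List ℂ} (h : L₁.Perm L₂) (v : ℂ) (k : ℕ) :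
    listEstar L₁ v k = listEstar L₂ v k := by
  induction h generalizing k with
  | nil => rfl
  | cons a h ih =>
    cases k with
    | zero => simp [listEstar_zero]
    | succ k => rw [listEstar_cons_succ, listEstar_cons_succ, ih, ih, h.length_eq]
  | swap a b L =>
    match k with
    | 0 => simp [listEstar_zero]
    | 1 =>
      simp only [listEstar_cons_succ, listEstar_zero, List.length_cons]
      push_cast
      ring
    | k + 2 =>
      simp only [listEstar_cons_succ, List.length_cons]
      push_cast
      ring
  | trans _ _ ih₁ ih₂ => rw [ih₁, ih₂]

theorem listEstar_shift (L : List ℂ) (v : ℂ) (k : ℕ) :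
    listEstar L v (k + 1) =
      listEstar L (v + 1) (k + 1) - (L.length - k) * listEstar L (v + 1) k := by
  induction L generalizing k with
  | nil =>
    cases k with
    | zero => simp [listEstar]
    | succ k => simp [listEstar]
  | cons a L ih =>
    cases k with
    | zero =>
      simp only [listEstar_cons_succ, listEstar_zero, ih 0, List.length_cons]
      push_cast
      ring
    | succ k =>
      simp only [listEstar_cons_succ, ih, List.length_cons]
      push_cast
      ring

/-- The alternating sum of shifted elementary symmetric functions removes a variable. -/
theorem sum_alternating_listEstar_cons (a : ℂ) (L : List ℂ) (v : ℂ) (k : ℕ) :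
    ∑ l ∈ Finset.range (k + 1),
        (-1) ^ l * risingFactorial (a + v) l * listEstar (a :: L) (v + l) (k - l) =
      listEstar L (v - 1) k := by
  induction k generalizing v with
  | zero => simp [listEstar_zero, risingFactorial_zero]
  | succ k ih =>
    have hrest : ∑ l ∈ Finset.range (k + 1), (-1) ^ (l + 1) * risingFactorial (a + v) (l + 1) *
        listEstar (a :: L) (v + (l + 1 : ℕ)) (k + 1 - (l + 1)) =
        -(a + v) * listEstar L v k := by
      have h := ih (v + 1)
      rw [add_sub_cancel_right] at h
      rw [← h, Finset.mul_sum]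
      refine Finset.sum_congr rfl fun l _ => ?_
      rw [risingFactorial_succ_left, Nat.add_sub_add_right, ← add_assoc a v 1,
        show v + ((l + 1 : ℕ) : ℂ) = v + 1 + l by push_cast; ring]
      ring
    have hs := listEstar_shift L (v - 1) k
    rw [sub_add_cancel] at hs
    rw [Finset.sum_range_succ', hrest, hs]
    simp only [pow_zero, risingFactorial_zero, Nat.cast_zero, add_zero, Nat.sub_zero,
      listEstar_cons_succ]
    ring

/-- Expansion of `∏ (x + m_i + v)` in rising factorials of `x`. -/
theorem prod_map_add_eq_sum_listEstar (L : List ℂ) (v x : ℂ) :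
    (L.map fun a => x + (a + v)).prod =
      ∑ k ∈ Finset.range (L.length + 1),
        listEstar L v k * risingFactorial x (L.length - k) := by
  induction L with
  | nil => simp [listEstar_zero, risingFactorial_zero]
  | cons a L ih =>
    have hshift : ∑ k ∈ Finset.range (L.length + 1),
          listEstar L v k * risingFactorial x (L.length + 1 - k) =
        ∑ k ∈ Finset.range (L.length + 1),
          listEstar L v (k + 1) * risingFactorial x (L.length - k) +
          risingFactorial x (L.length + 1) := by
      have h := Finset.sum_range_succ
        (fun k => listEstar L v k * risingFactorial x (L.length + 1 - k)) (L.length + 1)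
      rw [Finset.sum_range_succ', listEstar_eq_zero L v (L.length + 1) (by omega)] at h
      simp only [listEstar_zero, Nat.add_sub_add_right] at h
      linear_combination -h
    rw [List.map_cons, List.prod_cons, ih, List.length_cons,
      Finset.sum_range_succ' _ (L.length + 1), Finset.mul_sum]
    simp only [listEstar_cons_succ, listEstar_zero, Nat.add_sub_add_right, Nat.sub_zero, one_mul,
      add_mul (listEstar L v _), Finset.sum_add_distrib]
    rw [add_right_comm, ← hshift, ← Finset.sum_add_distrib]
    refine Finset.sum_congr rfl fun k hk => ?_
    have hk' : k ≤ L.length := Nat.lt_succ_iff.mp (Finset.mem_range.mp hk)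
    rw [Nat.sub_add_comm hk', risingFactorial_succ, Nat.cast_sub hk']
    ring

theorem risingFactorial_sub_risingFactorial_sub_one (x : ℂ) (j : ℕ) :
    risingFactorial x (j + 1) - risingFactorial (x - 1) (j + 1) =
      (j + 1) * risingFactorial x j := by
  rw [risingFactorial_succ, risingFactorial_succ_left (x - 1), sub_add_cancel]
  ring

/-- Backward difference of the expansion in rising factorials. -/
theorem sum_length_sub_mul_listEstar (L : List ℂ) (v x : ℂ) :
    ∑ k ∈ Finset.range L.length,
        (L.length - k) * listEstar L v k * risingFactorial x (L.length - 1 - k) =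
      (L.map fun a => x + (a + v)).prod - (L.map fun a => x - 1 + (a + v)).prod := by
  rw [prod_map_add_eq_sum_listEstar, prod_map_add_eq_sum_listEstar, Finset.sum_range_succ,
    Finset.sum_range_succ, Nat.sub_self, risingFactorial_zero, risingFactorial_zero,
    add_sub_add_right_eq_sub, ← Finset.sum_sub_distrib]
  refine Finset.sum_congr rfl fun k hk => ?_
  have hk' : k < L.length := Finset.mem_range.mp hk
  obtain ⟨j, hj⟩ : ∃ j, L.length = k + j + 1 := ⟨L.length - k - 1, by omega⟩
  rw [hj, show k + j + 1 - k = j + 1 by omega, show k + j + 1 - 1 - k = j by omega, ← mul_sub,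
    risingFactorial_sub_risingFactorial_sub_one]
  push_cast
  ring

theorem risingFactorial_neg_eq_zero {t j : ℕ} (h : t < j) : risingFactorial (-(t : ℂ)) j = 0 :=
  Finset.prod_eq_zero (Finset.mem_range.mpr h) (by ring)

theorem risingFactorial_neg_self_ne_zero (t : ℕ) : risingFactorial (-(t : ℂ)) t ≠ 0 := by
  refine Finset.prod_ne_zero_iff.mpr fun s hs h => ?_
  have hst : (s : ℂ) = t := by linear_combination h
  exact absurd (Nat.cast_injective hst) (Finset.mem_range.mp hs).ne

/-- A combination of rising factorials of degree less than `n` vanishing at `n` points is zero. -/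
theorem coeff_eq_zero_of_sum_risingFactorial_eq_zero {n : ℕ} (a : ℕ → ℂ) (y : Fin n → ℂ)
    (hy : Function.Injective y)
    (h : ∀ i, ∑ j ∈ Finset.range n, a j * risingFactorial (y i) j = 0) :
    ∀ j < n, a j = 0 := by
  let p : Polynomial ℂ := ∑ j ∈ Finset.range n,
    Polynomial.C (a j) * ∏ t ∈ Finset.range j, (Polynomial.X + Polynomial.C (t : ℂ))
  have heval : ∀ x, p.eval x = ∑ j ∈ Finset.range n, a j * risingFactorial x j := by
    intro x
    simp [p, Polynomial.eval_finsetSum, Polynomial.eval_prod, risingFactorial]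
  have hdeg : p.degree < (Finset.univ : Finset (Fin n)).card := by
    rw [Finset.card_univ, Fintype.card_fin]
    refine (Polynomial.degree_sum_le _ _).trans_lt ?_
    refine (Finset.sup_lt_iff (WithBot.bot_lt_coe n)).mpr fun j hj => ?_
    rw [← Polynomial.smul_eq_C_mul]
    refine (Polynomial.degree_smul_le _ _).trans_lt ?_
    simp only [Polynomial.degree_prod, Polynomial.degree_X_add_C, Finset.sum_const,
      Finset.card_range, nsmul_one]
    exact WithBot.coe_lt_coe.mpr (Finset.mem_range.mp hj)
  have hp : p = 0 := Polynomial.eq_zero_of_degree_lt_of_eval_index_eq_zero _ hy.injOn hdeg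
    fun i _ => (heval _).trans (h i)
  intro j
  induction j using Nat.strong_induction_on with
  | _ j ih =>
    intro hj
    have hsum : ∑ l ∈ Finset.range n, a l * risingFactorial (-(j : ℂ)) l = 0 := by
      rw [← heval, hp, Polynomial.eval_zero]
    rw [Finset.sum_eq_single_of_mem j (Finset.mem_range.mpr hj)] at hsum
    · exact (mul_eq_zero.mp hsum).resolve_right (risingFactorial_neg_self_ne_zero j)
    · intro l hl hlj
      rcases hlj.lt_or_gt with hlt | hgt
      · rw [ih l hlt (Finset.mem_range.mp hl), zero_mul]
      · rw [risingFactorial_neg_eq_zero hgt, mul_zero]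

theorem ofFn_perm_cons_ofFn_succAbove {N : ℕ} (m : Fin (N + 1) → ℂ) (i : Fin (N + 1)) :
    (List.ofFn m).Perm (m i :: List.ofFn fun j => m (i.succAbove j)) := by
  rw [← Multiset.coe_eq_coe, ← Multiset.cons_coe]
  have h (M : ℕ) (f : Fin M → ℂ) : (List.ofFn f : Multiset ℂ) = Finset.univ.val.map f := by
    simp [List.ofFn_eq_map]
  rw [h, h, Fin.univ_succAbove N i, Finset.cons_val, Multiset.map_cons, Finset.map_val,
    Multiset.map_map]
  rfl

/-- Partial fractions: the weighted sum of shifted elementary symmetric functions with one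
variable removed. -/
theorem sum_prod_mul_listEstar_succAbove {N : ℕ} (m : Fin (N + 1) → ℂ)
    (hm : Function.Injective m) (v : ℂ) (k : ℕ) :
    ∑ i, (∏ j, (1 - 1 / (m i - m (i.succAbove j)))) *
        listEstar (List.ofFn fun j => m (i.succAbove j)) (v - 1) k =
      (N + 1 - k) * listEstar (List.ofFn m) v k := by
  set γ : Fin (N + 1) → ℂ := fun i => ∏ j, (1 - 1 / (m i - m (i.succAbove j)))
  rcases lt_or_ge N k with hk | hk
  · rw [Finset.sum_eq_zero fun i _ => by rw [listEstar_eq_zero _ _ _ (by simpa using hk), mul_zero]]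
    rcases (Nat.succ_le_of_lt hk).eq_or_lt with rfl | hk
    · push_cast
      ring
    · rw [listEstar_eq_zero _ _ _ (by simpa using hk), mul_zero]
  let b : ℕ → ℂ := fun l =>
    ∑ i, γ i * listEstar (List.ofFn fun j => m (i.succAbove j)) (v - 1) l -
      (N + 1 - l) * listEstar (List.ofFn m) v l
  have hsum (x : ℂ) : ∑ j ∈ Finset.range (N + 1), b (N - j) * risingFactorial x j =
      ∑ i, γ i * ∏ j, (x + (m (i.succAbove j) + (v - 1))) -
        (∏ i, (x + (m i + v)) - ∏ i, (x - 1 + (m i + v))) := by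
    have h₁ (i : Fin (N + 1)) := prod_map_add_eq_sum_listEstar
      (List.ofFn fun j => m (i.succAbove j)) (v - 1) x
    have h₂ := sum_length_sub_mul_listEstar (List.ofFn m) v x
    simp only [List.map_ofFn, List.prod_ofFn, List.length_ofFn, Function.comp_apply] at h₁ h₂
    rw [← h₂, ← Finset.sum_range_reflect]
    simp only [h₁, Finset.mul_sum]
    rw [Finset.sum_comm, ← Finset.sum_sub_distrib]
    refine Finset.sum_congr rfl fun l hl => ?_
    have hl' : l ≤ N := Nat.lt_succ_iff.mp (Finset.mem_range.mp hl)
    rw [Nat.add_sub_cancel, Nat.sub_sub_self hl', sub_mul, Finset.sum_mul]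
    push_cast
    congr 1
    exact Finset.sum_congr rfl fun i _ => mul_assoc _ _ _
  have hb := coeff_eq_zero_of_sum_risingFactorial_eq_zero (fun j => b (N - j))
    (fun i => 1 - v - m i) (fun i i' h => hm (by linear_combination -h)) (fun i => ?_)
    (N - k) (by omega)
  · simp only [Nat.sub_sub_self hk] at hb
    exact sub_eq_zero.mp hb
  · rw [hsum, Finset.sum_eq_single_of_mem i (Finset.mem_univ i),
      Finset.prod_eq_zero (f := fun i' => 1 - v - m i - 1 + (m i' + v)) (Finset.mem_univ i)
        (show 1 - v - m i - 1 + (m i + v) = 0 by ring),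
      sub_zero, Fin.prod_univ_succAbove _ i, ← Finset.prod_mul_distrib, sub_eq_zero,
      show 1 - v - m i + (m i + v) = 1 by ring, one_mul]
    · refine Finset.prod_congr rfl fun j _ => ?_
      have hne : m i - m (i.succAbove j) ≠ 0 :=
        sub_ne_zero.mpr fun h => Fin.succAbove_ne i j (hm h).symm
      field_simp
      ring
    · intro i' _ hi'
      obtain ⟨j, rfl⟩ := Fin.exists_succAbove_eq hi'.symm
      rw [Finset.prod_eq_zero (Finset.mem_univ j) (by ring), mul_zero]

theorem gammaCoef_succ {N : ℕ} (μ : Fin (N + 1) → ℂ) (i : Fin (N + 1)) :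
    gammaCoef (N + 1) μ i =
      ∏ j, (1 - 1 / (mshift (N + 1) μ i - mshift (N + 1) μ (i.succAbove j))) := by
  rw [gammaCoef, Fin.univ_succAbove N i, Finset.erase_cons, Finset.prod_map]
  rfl

/-- The Newton identity for the shifted elementary symmetric functions and power sums. -/
theorem sum_alternating_listEstar_mul_pstar {N : ℕ} (μ : Fin (N + 1) → ℂ)
    (hm : Function.Injective (mshift (N + 1) μ)) (v : ℂ) (k : ℕ) :
    ∑ l ∈ Finset.range k, (-1) ^ l *
        listEstar (List.ofFn (mshift (N + 1) μ)) (v + (l + 1 : ℕ)) (k - (l + 1)) *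
        pstar (N + 1) μ (l + 1) v =
      k * listEstar (List.ofFn (mshift (N + 1) μ)) v k := by
  set m := mshift (N + 1) μ
  set L := List.ofFn m
  have hpstar (l : ℕ) : pstar (N + 1) μ l v =
      ∑ i, gammaCoef (N + 1) μ i * risingFactorial (m i + v) l := rfl
  have hremove (i : Fin (N + 1)) :
      ∑ l ∈ Finset.range k, (-1) ^ l * risingFactorial (m i + v) (l + 1) *
          listEstar L (v + (l + 1 : ℕ)) (k - (l + 1)) =
        listEstar L v k - listEstar (List.ofFn fun j => m (i.succAbove j)) (v - 1) k := by
    rw [← sum_alternating_listEstar_cons (m i), Finset.sum_range_succ']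
    simp only [← listEstar_perm (ofFn_perm_cons_ofFn_succAbove m i), pow_succ, pow_zero,
      risingFactorial_zero, Nat.cast_zero, add_zero, Nat.sub_zero, mul_neg_one, neg_mul,
      Finset.sum_neg_distrib]
    ring
  have hone := sum_prod_mul_listEstar_succAbove m hm v 0
  have hk := sum_prod_mul_listEstar_succAbove m hm v k
  simp only [m, ← gammaCoef_succ, listEstar_zero, mul_one, Nat.cast_zero, sub_zero] at hone hk
  calc
    _ = ∑ i, gammaCoef (N + 1) μ i * ∑ l ∈ Finset.range k, (-1) ^ l *
          risingFactorial (m i + v) (l + 1) * listEstar L (v + (l + 1 : ℕ)) (k - (l + 1)) := by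
      simp only [hpstar, Finset.mul_sum]
      rw [Finset.sum_comm]
      refine Finset.sum_congr rfl fun i _ => Finset.sum_congr rfl fun l _ => ?_
      ring
    _ = k * listEstar L v k := by
      simp only [hremove, mul_sub, Finset.sum_sub_distrib, ← Finset.sum_mul]
      rw [hone, hk]
      ring

theorem estar_zero_right (n : ℕ) (μ : Fin n → ℂ) (u : ℂ) : estar n μ 0 u = 1 := by
  simp [estar]

theorem estar_succ_succ (n : ℕ) (μ : Fin (n + 1) → ℂ) (k : ℕ) (u : ℂ) :
    estar (n + 1) μ (k + 1) u =
      estar n (fun i => μ i.succ) (k + 1) u +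
        (μ 0 + u + k) * estar n (fun i => μ i.succ) k u := by
  have hmem (a b : ℕ) (φ : Fin a → Fin b) :
      φ ∈ Finset.univ.filter (fun φ : Fin a → Fin b => ∀ i j : Fin a, i < j → φ i < φ j) ↔
        StrictMono φ := by
    simp [StrictMono]
  rw [estar, ← Finset.sum_filter_not_add_sum_filter _ (fun φ => φ 0 = 0), estar, estar,
    Finset.mul_sum]
  congr 1
  · symm
    refine Finset.sum_bij (fun ψ _ i => (ψ i).succ) ?_ ?_ ?_ ?_
    · intro ψ hψ
      rw [hmem] at hψ
      rw [Finset.mem_filter, hmem]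
      exact ⟨fun i j hij => Fin.succ_lt_succ_iff.mpr (hψ hij), Fin.succ_ne_zero _⟩
    · intro ψ _ ψ' _ h
      exact funext fun i => Fin.succ_injective _ (congrFun h i)
    · intro φ hφ
      rw [Finset.mem_filter, hmem] at hφ
      have hne (i : Fin (k + 1)) : φ i ≠ 0 := fun h =>
        hφ.2 (Fin.le_zero_iff.mp (h ▸ hφ.1.monotone (Fin.zero_le i)))
      refine ⟨fun i => (φ i).pred (hne i), ?_, funext fun i => Fin.succ_pred _ _⟩
      rw [hmem]
      exact fun i j hij => Fin.pred_lt_pred_iff.mpr (hφ.1 hij)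
    · intro ψ _
      rfl
  · symm
    refine Finset.sum_bij (fun ψ _ => Fin.cons 0 fun i => (ψ i).succ) ?_ ?_ ?_ ?_
    · intro ψ hψ
      rw [hmem] at hψ
      rw [Finset.mem_filter, hmem]
      refine ⟨?_, Fin.cons_zero _ _⟩
      intro i j hij
      cases j using Fin.cases with
      | zero => exact absurd hij (Fin.not_lt_zero i)
      | succ j =>
        cases i using Fin.cases with
        | zero => simp
        | succ i => simpa using hψ (Fin.succ_lt_succ_iff.mp hij)
    · intro ψ _ ψ' _ h
      exact funext fun i => Fin.succ_injective _ (congrFun (Fin.cons_right_injective _ h) i)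
    · intro φ hφ
      rw [Finset.mem_filter, hmem] at hφ
      have hne (i : Fin k) : φ i.succ ≠ 0 := by
        have h := hφ.1 (Fin.succ_pos i)
        rw [hφ.2] at h
        exact h.ne'
      refine ⟨fun i => (φ i.succ).pred (hne i), ?_, ?_⟩
      · rw [hmem]
        exact fun i j hij => Fin.pred_lt_pred_iff.mpr (hφ.1 (Fin.succ_lt_succ_iff.mpr hij))
      · funext i
        cases i using Fin.cases with
        | zero => simp [hφ.2]
        | succ i => simp
    · intro ψ _
      rw [Fin.prod_univ_succ]
      simp only [Fin.cons_zero, Fin.cons_succ, Fin.val_zero, Fin.val_succ]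
      congr 1
      · push_cast
        ring
      · refine Finset.prod_congr rfl fun i _ => ?_
        push_cast
        ring

theorem mshift_zero (n : ℕ) (μ : Fin (n + 1) → ℂ) : mshift (n + 1) μ 0 = μ 0 + n := by
  simp [mshift]
  ring

theorem mshift_succ (n : ℕ) (μ : Fin (n + 1) → ℂ) (i : Fin n) :
    mshift (n + 1) μ i.succ = mshift n (fun i => μ i.succ) i := by
  simp [mshift]
  ring

theorem estar_eq_listEstar (n : ℕ) (μ : Fin n → ℂ) (k : ℕ) (u : ℂ) :
    estar n μ k u = listEstar (List.ofFn (mshift n μ)) u k := by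
  induction n generalizing k with
  | zero =>
    cases k with
    | zero => rw [estar_zero_right, listEstar_zero]
    | succ k => simp [estar, listEstar]
  | succ n ih =>
    cases k with
    | zero => rw [estar_zero_right, listEstar_zero]
    | succ k =>
      rw [estar_succ_succ, ih, ih, List.ofFn_succ, listEstar_cons_succ, mshift_zero,
        List.length_ofFn]
      simp only [mshift_succ]
      ring

theorem prod_get_take_sum_append_singleton (g : ℕ → ℕ → ℂ) (l : List ℕ) (b : ℕ) :
    ∏ i : Fin (l ++ [b]).length, g ((l ++ [b]).get i) (((l ++ [b]).take (i + 1)).sum) =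
      (∏ i : Fin l.length, g (l.get i) ((l.take (i + 1)).sum)) * g b (l.sum + b) := by
  have h (l : List ℕ) : ∏ i : Fin l.length, g (l.get i) ((l.take (i + 1)).sum) =
      ∏ i ∈ Finset.range l.length, g (l.getD i 0) ((l.take (i + 1)).sum) := by
    rw [Finset.prod_range]
    simp
  rw [h, h, List.length_append, List.length_singleton, Finset.prod_range_succ]
  congr 1
  · refine Finset.prod_congr rfl fun i hi => ?_
    have hi' : i < l.length := Finset.mem_range.mp hi
    rw [List.getD_append _ _ _ _ hi', List.take_append_of_le_length hi']
  · simp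

/-- A weighted sum over compositions satisfies the recursion given by removing the last block. -/
theorem sum_composition_succ (g : ℕ → ℕ → ℂ) (k : ℕ) :
    ∑ c : Composition (k + 1), ∏ i, g (c.blocksFun i) (c.sizeUpTo (i + 1)) =
      ∑ j : Fin (k + 1), g (k + 1 - j) (k + 1) *
        ∑ c : Composition j, ∏ i, g (c.blocksFun i) (c.sizeUpTo (i + 1)) := by
  simp only [Finset.mul_sum]
  rw [← Fintype.sum_sigma']
  symm
  let snoc : (Σ j : Fin (k + 1), Composition j) → Composition (k + 1) := fun x =>
    (x.2.append (Composition.single (k + 1 - x.1) (by omega))).cast (by omega)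
  have hblocks (x) : (snoc x).blocks = x.2.blocks ++ [k + 1 - (x.1 : ℕ)] := rfl
  refine Fintype.sum_bijective snoc ⟨?_, ?_⟩ _ _ ?_
  · rintro ⟨j, c⟩ ⟨j', c'⟩ h
    have h' := congrArg Composition.blocks h
    rw [hblocks, hblocks] at h'
    have hc : c.blocks = c'.blocks := (List.append_inj' h' rfl).1
    obtain rfl : j = j' := Fin.ext (by rw [← c.blocks_sum, ← c'.blocks_sum, hc])
    rw [Composition.ext hc]
  · intro c
    have hne : c.blocks ≠ [] := by simp
    have hsum := c.blocks_sum
    have hpos := c.blocks_pos (List.getLast_mem hne)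
    rw [← List.dropLast_append_getLast hne, List.sum_append, List.sum_singleton] at hsum
    refine ⟨⟨⟨c.blocks.dropLast.sum, by omega⟩, ⟨c.blocks.dropLast,
      fun h => c.blocks_pos (List.mem_of_mem_dropLast h), rfl⟩⟩, ?_⟩
    ext1
    rw [hblocks]
    conv_rhs => rw [← List.dropLast_append_getLast hne]
    congr 2
    simp only
    omega
  · rintro ⟨j, c⟩
    have h := prod_get_take_sum_append_singleton g c.blocks (k + 1 - j)
    rw [c.blocks_sum, Nat.add_sub_cancel' (by omega)] at h
    rw [mul_comm]
    exact h.symm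

theorem neg_one_pow_sub_length {k : ℕ} (c : Composition k) :
    (-1 : ℂ) ^ (k - c.length) = ∏ i, (-1 : ℂ) ^ (c.blocksFun i - 1) := by
  rw [Finset.prod_pow_eq_pow_sum]
  congr 1
  have h : ∑ i, (c.blocksFun i - 1 + 1) = k := by
    refine Eq.trans ?_ c.sum_blocksFun
    exact Finset.sum_congr rfl fun i _ => Nat.sub_add_cancel (c.one_le_blocksFun i)
  rw [Finset.sum_add_distrib] at h
  simp only [Finset.sum_const, Finset.card_univ, Fintype.card_fin, smul_eq_mul, mul_one] at h
  omega

/-- If the `m_i` are pairwise distinct, then `e*_k(u−k)` equals the sum over all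
compositions `λ = (λ_1,…,λ_m)` of `k` of
`((−1)^{k−m}/(a_1⋯a_m)) p*_{λ_1}(u−a_1) p*_{λ_2}(u−a_2) ⋯ p*_{λ_m}(u−a_m)`,
where `a_i = λ_1 + ⋯ + λ_i`. -/
theorem estar_eq_sum_compositions (n : ℕ) (hn : 1 ≤ n) (μ : Fin n → ℂ)
    (hdist : ∀ i j : Fin n, i ≠ j → mshift n μ i ≠ mshift n μ j)
    (k : ℕ) (hk : 1 ≤ k) (u : ℂ) :
    estar n μ k (u - (k : ℂ)) =
      ∑ c : Composition k,
        (((-1 : ℂ) ^ (k - c.length)) /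
            ∏ i ∈ Finset.range c.length, ((c.sizeUpTo (i + 1) : ℕ) : ℂ)) *
          ∏ i : Fin c.length,
            pstar n μ (c.blocksFun i) (u - ((c.sizeUpTo ((i : ℕ) + 1) : ℕ) : ℂ)) := by
  obtain ⟨N, rfl⟩ : ∃ N, n = N + 1 := ⟨n - 1, by omega⟩
  have hm : Function.Injective (mshift (N + 1) μ) := fun i j h => by
    by_contra hij
    exact hdist i j hij h
  let g : ℕ → ℕ → ℂ := fun l a => (-1) ^ (l - 1) / a * pstar (N + 1) μ l (u - a)
  have hterm (k : ℕ) (c : Composition k) :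
      ((-1 : ℂ) ^ (k - c.length)) /
            (∏ i ∈ Finset.range c.length, ((c.sizeUpTo (i + 1) : ℕ) : ℂ)) *
          ∏ i : Fin c.length,
            pstar (N + 1) μ (c.blocksFun i) (u - ((c.sizeUpTo ((i : ℕ) + 1) : ℕ) : ℂ)) =
        ∏ i, g (c.blocksFun i) (c.sizeUpTo (i + 1)) := by
    rw [neg_one_pow_sub_length, Finset.prod_range, ← Finset.prod_div_distrib,
      ← Finset.prod_mul_distrib]
  simp only [hterm, estar_eq_listEstar]
  clear hterm hk
  induction k using Nat.strong_induction_on with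
  | _ k ih =>
    cases k with
    | zero =>
      have huniv : (Finset.univ : Finset (Composition 0)) = {Composition.ones 0} := by
        refine Finset.eq_singleton_iff_unique_mem.mpr ⟨Finset.mem_univ _, fun c _ => ?_⟩
        exact Composition.ext ((c.blocks_eq_nil.mpr rfl).trans (by simp))
      rw [listEstar_zero, huniv, Finset.sum_singleton]
      exact Finset.prod_empty.symm
    | succ k =>
      have hk : ((k + 1 : ℕ) : ℂ) ≠ 0 := Nat.cast_ne_zero.mpr k.succ_ne_zero
      rw [sum_composition_succ, ← mul_right_inj' hk, ← sum_alternating_listEstar_mul_pstar μ hm,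
        ← Finset.sum_range_reflect, Finset.sum_range, Finset.mul_sum]
      refine Finset.sum_congr rfl fun j _ => ?_
      obtain ⟨l, hl⟩ : ∃ l, k = j + l := ⟨k - j, by omega⟩
      rw [← ih j j.isLt, show k + 1 - 1 - (j : ℕ) = l by omega,
        show k + 1 - (l + 1) = (j : ℕ) by omega, show k + 1 - (j : ℕ) = l + 1 by omega,
        show u - ((k + 1 : ℕ) : ℂ) + ((l + 1 : ℕ) : ℂ) = u - (j : ℕ) by
          have hl' : (k : ℂ) = (j : ℕ) + l := by exact_mod_cast hl
          push_cast
          rw [hl']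
          ring]
      simp only [g, Nat.add_sub_cancel]
      field_simp
end

section
/- Assume the numbers m_i := μ_i + n − i (1 ≤ i ≤ n) are pairwise distinct. Then for every k ≥ 1 and every u ∈ ℂ, h*_k(u+k−1) = Σ over all compositions λ = (λ_1,…,λ_m) of k of (1 / (a_1 a_2 ⋯ a_m)) · p*_{λ_1}(u) · p*_{λ_2}(u+a_1) ⋯ p*_{λ_m}(u+a_{m−1}), where a_i := λ_1 + ⋯ + λ_i and a_0 := 0. -/
open Finset Polynomial

/-- The rising factorial `x (x + 1) ⋯ (x + k - 1)`. -/
def risingFac (x : ℂ) (k : ℕ) : ℂ := ∏ t ∈ range k, (x + (t : ℂ))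

theorem risingFac_succ (x : ℂ) (k : ℕ) : risingFac x (k + 1) = risingFac x k * (x + k) :=
  prod_range_succ _ _

theorem risingFac_succ_left (x : ℂ) (k : ℕ) :
    risingFac x (k + 1) = x * risingFac (x + 1) k := by
  rw [risingFac, prod_range_succ', mul_comm]
  simp only [risingFac, Nat.cast_add, Nat.cast_one, Nat.cast_zero, add_zero]
  congr 1
  exact prod_congr rfl fun t _ => by ring

theorem risingFac_add (x : ℂ) (a b : ℕ) :
    risingFac x (a + b) = risingFac x a * risingFac (x + a) b := by
  rw [risingFac, prod_range_add]
  simp only [risingFac, Nat.cast_add, add_assoc]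

theorem risingFac_add_eq_prod_sub (x c : ℂ) (k : ℕ) :
    risingFac (x + c) k = ∏ t ∈ range k, (x - -(c + (t : ℂ))) :=
  prod_congr rfl fun t _ => by ring

/-- Summation of the products of two rising factorials by telescoping. -/
theorem sum_risingFac_mul_risingFac (a b : ℂ) (r k : ℕ) :
    (a + r - b + 1) * ∑ l ∈ range k, risingFac a (l + r) * risingFac (b + l) (k - l) =
      risingFac a (k + r) * (b + k - 1) - risingFac a r * risingFac (b - 1) (k + 1) := by
  have key : ∀ l ∈ range k,
      (a + r - b + 1) * (risingFac a (l + r) * risingFac (b + l) (k - l)) =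
        risingFac a (l + 1 + r) * risingFac (b + (l + 1 : ℕ) - 1) (k - (l + 1) + 1) -
          risingFac a (l + r) * risingFac (b + l - 1) (k - l + 1) := by
    intro l hl
    have hl : l < k := mem_range.1 hl
    rw [show k - (l + 1) + 1 = k - l by omega, show l + 1 + r = l + r + 1 by omega,
      risingFac_succ, risingFac_succ_left (b + l - 1)]
    push_cast
    rw [show b + (l + 1) - 1 = b + (l : ℂ) by ring, show b + (l : ℂ) - 1 + 1 = b + l by ring]
    ring
  rw [mul_sum, sum_congr rfl key,
    sum_range_sub (fun l => risingFac a (l + r) * risingFac (b + l - 1) (k - l + 1))]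
  simp [risingFac]

section Lagrange

variable {ι κ : Type*} [Fintype ι] [DecidableEq ι]

/-- The derivative `∏_{j ≠ i} (v_i - v_j)` of the nodal polynomial at the node `v_i`. -/
def nodeDiff (v : ι → ℂ) (i : ι) : ℂ := ∏ j ∈ univ.erase i, (v i - v j)

theorem nodeDiff_ne_zero {v : ι → ℂ} (hv : Function.Injective v) (i : ι) : nodeDiff v i ≠ 0 :=
  prod_ne_zero_iff.2 fun _ hj => sub_ne_zero.2 (hv.ne (ne_of_mem_erase hj).symm)

theorem sum_prod_sub_div_nodeDiff {v : ι → ℂ} (hv : Function.Injective v) (s : Finset κ)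
    (w : κ → ℂ) (hs : #s + 1 = Fintype.card ι) :
    ∑ i, (∏ t ∈ s, (v i - w t)) / nodeDiff v i = 1 := by
  have h := Lagrange.leadingCoeff_eq_sum (s := univ) (v := v) hv.injOn (P := Lagrange.nodal s w)
    (by rw [Lagrange.degree_nodal, card_univ, ← hs]; rfl)
  rw [Lagrange.nodal_monic.leadingCoeff] at h
  simpa only [Lagrange.eval_nodal, nodeDiff] using h.symm

theorem sum_prod_sub_div_nodeDiff_mul_prod {v : ι → ℂ} (hv : Function.Injective v)
    (s : Finset κ) (w : κ → ℂ) (hs : #s < Fintype.card ι) (z : ℂ) :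
    ∑ j, (∏ t ∈ s, (v j - w t)) / nodeDiff v j * ∏ l ∈ univ.erase j, (z - v l) =
      ∏ t ∈ s, (z - w t) := by
  have h := Lagrange.eq_interpolate (s := univ) (v := v) hv.injOn (f := Lagrange.nodal s w)
    (by rw [Lagrange.degree_nodal, card_univ]; exact_mod_cast hs)
  have h' := congrArg (eval z) h
  rw [Lagrange.interpolate_apply, eval_finsetSum] at h'
  rw [← Lagrange.eval_nodal (v := w), h']
  refine sum_congr rfl fun j _ => ?_
  simp only [eval_mul, eval_C, Lagrange.eval_nodal, Lagrange.basis, Lagrange.basisDivisor,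
    eval_prod, eval_sub, eval_X, prod_mul_distrib, prod_inv_distrib, nodeDiff]
  ring

theorem sum_prod_sub_sub_one_div_nodeDiff [Nonempty ι] {v : ι → ℂ}
    (hv : Function.Injective v) :
    ∑ i, (∏ l, (v i - v l - 1)) / nodeDiff v i = -(Fintype.card ι : ℂ) := by
  have hcard : 0 < #(univ : Finset ι) := Fintype.card_pos
  have hdeg : (Lagrange.nodal univ (fun i => v i + 1) - Lagrange.nodal univ v).degree <
      #(univ : Finset ι) := by
    rw [← Lagrange.degree_nodal (s := univ) (v := fun i => v i + 1)]
    exact degree_sub_lt_left (by simp only [Lagrange.degree_nodal]) Lagrange.nodal_ne_zero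
      (by simp only [Lagrange.nodal_monic.leadingCoeff])
  have h := Lagrange.coeff_eq_sum (s := univ) (v := v) hv.injOn hdeg
  rw [coeff_sub, Lagrange.nodal_eq, Lagrange.nodal_eq, prod_X_sub_C_coeff_card_pred _ _ hcard,
    prod_X_sub_C_coeff_card_pred _ _ hcard, ← Lagrange.nodal_eq, ← Lagrange.nodal_eq] at h
  simp only [eval_sub, Lagrange.eval_nodal_at_node (mem_univ _), Lagrange.eval_nodal,
    sub_zero, sum_add_distrib, sum_const, card_univ, nsmul_eq_mul, mul_one] at h
  simp only [sub_sub, nodeDiff]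
  rw [← h]
  ring

/-- The explicit form of the shifted homogeneous symmetric functions in the variables `v`,
where `r + 1` is the number of variables. -/
noncomputable def homSum (v : ι → ℂ) (r k : ℕ) (u : ℂ) : ℂ :=
  ∑ i, risingFac (v i + (u - r)) (k + r) / nodeDiff v i

theorem prod_one_sub_inv_eq {v : ι → ℂ} (hv : Function.Injective v) (i j : ι) :
    ∏ l ∈ univ.erase i, (1 - 1 / (v i - v l)) =
      (∏ l ∈ univ.erase j, (v i - v l - 1)) / nodeDiff v i * (v j - v i + 1) := by
  have h1 : ∏ l ∈ univ.erase i, (1 - 1 / (v i - v l)) =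
      (∏ l ∈ univ.erase i, (v i - v l - 1)) / nodeDiff v i := by
    rw [nodeDiff, ← prod_div_distrib]
    refine prod_congr rfl fun l hl => ?_
    have := sub_ne_zero.2 (hv.ne (ne_of_mem_erase hl).symm)
    field_simp
  have h2 := mul_prod_erase univ (fun l => v i - v l - 1) (mem_univ i)
  have h3 := mul_prod_erase univ (fun l => v i - v l - 1) (mem_univ j)
  rw [h1, div_mul_eq_mul_div]
  congr 1
  linear_combination h3 - h2

/-- Newton's identity for the shifted homogeneous symmetric functions. -/
theorem sum_homSum_mul {v : ι → ℂ} (hv : Function.Injective v) (r k : ℕ)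
    (hr : r + 1 = Fintype.card ι) (u : ℂ) :
    ∑ l ∈ range k, homSum v r l u *
        ∑ i, (∏ j ∈ univ.erase i, (1 - 1 / (v i - v j))) * risingFac (v i + (u + l)) (k - l) =
      k * homSum v r k u := by
  have : Nonempty ι := Fintype.card_pos_iff.1 (by omega)
  set γ : ι → ℂ := fun i => ∏ j ∈ univ.erase i, (1 - 1 / (v i - v j))
  set g : ι → ι → ℂ := fun i j => (∏ l ∈ univ.erase j, (v i - v l - 1)) / nodeDiff v i with hg
  have hγg : ∀ i j, γ i = g i j * (v j - v i + 1) := prod_one_sub_inv_eq hv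
  have hγsum : ∑ i, γ i = r + 1 := by
    have h := sum_prod_sub_sub_one_div_nodeDiff hv
    rw [← hr] at h
    push_cast at h
    rw [← neg_inj, ← h, ← sum_neg_distrib]
    refine sum_congr rfl fun i _ => ?_
    rw [hγg i i, hg, ← mul_prod_erase univ (fun l => v i - v l - 1) (mem_univ i)]
    ring
  have hcard : ∀ j : ι, #(univ.erase j) + 1 = Fintype.card ι := fun j => by
    rw [card_erase_of_mem (mem_univ j), card_univ]; omega
  have hgsum : ∀ j, ∑ i, g i j = 1 := by
    intro j
    simpa only [hg, sub_sub] using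
      sum_prod_sub_div_nodeDiff hv (univ.erase j) (fun l => v l + 1) (hcard j)
  have hfirst : ∀ j, ∑ i, g i j * (v i + u + k - 1) = v j + u + k - (r + 1) := by
    intro j
    calc
      _ = ∑ i, ((v j + u + k) * g i j - γ i) :=
        sum_congr rfl fun i _ => by rw [hγg i j]; ring
      _ = _ := by rw [sum_sub_distrib, ← mul_sum, hgsum, hγsum, mul_one]
  have hsecond : ∀ i, ∑ j, g i j * (risingFac (v j + (u - r)) r / nodeDiff v j) =
      risingFac (v i - 1 + (u - r)) r / nodeDiff v i := by
    intro i
    rw [risingFac_add_eq_prod_sub, ← sum_prod_sub_div_nodeDiff_mul_prod hv (range r)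
      (fun t => -(u - r + (t : ℂ))) (by rw [card_range]; omega) (v i - 1), sum_div]
    refine sum_congr rfl fun j _ => ?_
    simp only [hg, risingFac_add_eq_prod_sub, sub_right_comm (v i) _ (1 : ℂ)]
    ring
  have htel : ∀ i j, γ i * ∑ l ∈ range k,
      risingFac (v j + (u - r)) (l + r) * risingFac (v i + (u + l)) (k - l) =
        g i j * (risingFac (v j + (u - r)) (k + r) * (v i + u + k - 1) -
          risingFac (v j + (u - r)) r * risingFac (v i + u - 1) (k + 1)) := by
    intro i j
    rw [← sum_risingFac_mul_risingFac, hγg i j]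
    simp only [← add_assoc]
    ring
  calc
    _ = ∑ i, ∑ j, (γ i * ∑ l ∈ range k, risingFac (v j + (u - r)) (l + r) *
          risingFac (v i + (u + l)) (k - l)) / nodeDiff v j := by
      simp only [homSum, sum_mul_sum]
      simp only [mul_sum, sum_div]
      rw [sum_comm, sum_comm (s := univ) (t := univ)]
      refine sum_congr rfl fun j _ => ?_
      rw [sum_comm]
      exact sum_congr rfl fun i _ => sum_congr rfl fun l _ => by ring
    _ = ∑ j, risingFac (v j + (u - r)) (k + r) / nodeDiff v j *
          ∑ i, g i j * (v i + u + k - 1) -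
        ∑ i, risingFac (v i + u - 1) (k + 1) *
          ∑ j, g i j * (risingFac (v j + (u - r)) r / nodeDiff v j) := by
      simp only [htel, mul_sum]
      rw [sum_comm (s := univ) (t := univ) (f := fun j i => _ * (g i j * (v i + u + k - 1)))]
      simp only [← sum_sub_distrib]
      refine sum_congr rfl fun i _ => sum_congr rfl fun j _ => ?_
      ring
    _ = _ := by
      simp only [hfirst, hsecond, homSum, mul_sum, ← sum_sub_distrib]
      refine sum_congr rfl fun i _ => ?_
      have h1 := risingFac_add (v i - 1 + (u - r)) r (k + 1)
      rw [show r + (k + 1) = k + r + 1 by omega, risingFac_succ_left,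
        show v i - 1 + (u - r) + 1 = v i + (u - r) by ring,
        show v i - 1 + (u - r) + (r : ℂ) = v i + u - 1 by ring] at h1
      linear_combination h1 / nodeDiff v i

end Lagrange

theorem mshift_castSucc (n : ℕ) (μ : Fin (n + 1) → ℂ) (i : Fin n) :
    mshift (n + 1) μ i.castSucc = mshift n (fun j => μ j.castSucc) i + 1 := by
  simp only [mshift, Fin.val_castSucc]
  push_cast
  ring

theorem mshift_last (n : ℕ) (μ : Fin (n + 1) → ℂ) :
    mshift (n + 1) μ (Fin.last n) = μ (Fin.last n) := by
  simp [mshift]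

/-- Splitting the weakly increasing tuples by whether their last entry is the last index. -/
theorem hstar_succ_succ (n k : ℕ) (μ : Fin (n + 1) → ℂ) (u : ℂ) :
    hstar (n + 1) μ (k + 1) (u + (k + 1 : ℕ) - 1) =
      hstar n (fun j => μ j.castSucc) (k + 1) (u + (k + 1 : ℕ) - 1) +
        hstar (n + 1) μ k (u + k - 1) * (μ (Fin.last n) + u + k) := by
  unfold hstar
  rw [← sum_filter_not_add_sum_filter _ (fun φ => φ (Fin.last k) = Fin.last n), sum_mul,
    filter_filter, filter_filter]
  congr 1
  · symm
    refine sum_bij (fun ψ _ j => (ψ j).castSucc) ?_ ?_ ?_ ?_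
    · intro ψ hψ
      simp only [mem_filter, mem_univ, true_and] at hψ ⊢
      exact ⟨fun i j hij => Fin.castSucc_le_castSucc_iff.2 (hψ i j hij), Fin.castSucc_ne_last _⟩
    · intro ψ _ χ _ h
      exact funext fun j => Fin.castSucc_injective _ (congrFun h j)
    · intro φ hφ
      simp only [mem_filter, mem_univ, true_and] at hφ
      have hne : ∀ j, φ j ≠ Fin.last n := fun j hj =>
        hφ.2 (Fin.last_le_iff.1 (hj ▸ hφ.1 j (Fin.last k) (Fin.le_last j)))
      refine ⟨fun j => (φ j).castPred (hne j), ?_, by simp⟩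
      simp only [mem_filter, mem_univ, true_and]
      exact fun i j hij => Fin.castPred_le_castPred (hφ.1 i j hij) _
    · intros
      rfl
  · symm
    refine sum_bij (fun ψ _ => Fin.snoc (α := fun _ => Fin (n + 1)) ψ (Fin.last n)) ?_ ?_ ?_ ?_
    · intro ψ hψ
      simp only [mem_filter, mem_univ, true_and] at hψ ⊢
      refine ⟨fun i j => ?_, by simp⟩
      induction j using Fin.lastCases with
      | last => simp [Fin.le_last]
      | cast j =>
        induction i using Fin.lastCases with
        | last => exact fun h => absurd h (not_le.2 (Fin.castSucc_lt_last j))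
        | cast i => simpa using hψ i j
    · intro ψ _ χ _ h
      exact (Fin.snoc_injective2 h).1
    · intro φ hφ
      simp only [mem_filter, mem_univ, true_and] at hφ
      refine ⟨Fin.init φ, ?_, ?_⟩
      · simp only [mem_filter, mem_univ, true_and]
        exact fun i j hij => hφ.1 _ _ (Fin.castSucc_le_castSucc_iff.2 hij)
      · rw [← hφ.2, Fin.snoc_init_self]
    · intro ψ _
      rw [Fin.prod_univ_castSucc]
      simp only [Fin.snoc_castSucc, Fin.snoc_last, Fin.val_castSucc, Fin.val_last]
      push_cast
      congr 1
      · exact prod_congr rfl fun j _ => by ring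
      · ring

theorem nodeDiff_add_const {n : ℕ} (v : Fin n → ℂ) (c : ℂ) (i : Fin n) :
    nodeDiff (fun j => v j + c) i = nodeDiff v i := by
  simp [nodeDiff]

theorem nodeDiff_castSucc {n : ℕ} (v : Fin (n + 1) → ℂ) (i : Fin n) :
    nodeDiff v i.castSucc =
      nodeDiff (fun j : Fin n => v j.castSucc) i * (v i.castSucc - v (Fin.last n)) := by
  have h : (univ.erase i.castSucc : Finset (Fin (n + 1))) =
      insert (Fin.last n) ((univ.erase i).map Fin.castSuccEmb) := by
    ext j
    induction j using Fin.lastCases with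
    | last => simp [(Fin.castSucc_ne_last i).symm]
    | cast j => simp [Fin.castSucc_ne_last]
  rw [nodeDiff, h, prod_insert (by simp), prod_map, mul_comm]
  rfl

theorem homSum_succ_of_injective {r : ℕ} {v : Fin (r + 1) → ℂ} (hv : Function.Injective v)
    (k : ℕ) (u : ℂ) :
    homSum v r (k + 1) u =
      ∑ i : Fin r, risingFac (v i.castSucc + (u - r)) (k + r) /
          nodeDiff (fun j : Fin r => v j.castSucc) i +
        homSum v r k u * (v (Fin.last r) + u + k) := by
  have hlast : ∀ x : ℂ, risingFac (x + (u - r)) (k + 1 + r) =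
      risingFac (x + (u - r)) (k + r) * (x + u + k) := fun x => by
    rw [show k + 1 + r = k + r + 1 by omega, risingFac_succ]
    push_cast
    ring
  have hd := nodeDiff_ne_zero hv
  rw [homSum, homSum, Fin.sum_univ_castSucc, Fin.sum_univ_castSucc, add_mul, sum_mul,
    ← add_assoc, ← sum_add_distrib]
  congr 1
  · refine sum_congr rfl fun i _ => ?_
    have hi := hd i.castSucc
    rw [nodeDiff_castSucc] at hi
    rw [nodeDiff_castSucc, hlast]
    have h1 := left_ne_zero_of_mul hi
    have h2 := right_ne_zero_of_mul hi
    field_simp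
    ring
  · rw [hlast]
    ring

theorem hstar_eq_homSum (r : ℕ) (μ : Fin (r + 1) → ℂ)
    (hv : Function.Injective (mshift (r + 1) μ)) (k : ℕ) (u : ℂ) :
    hstar (r + 1) μ k (u + k - 1) = homSum (mshift (r + 1) μ) r k u := by
  induction k generalizing r with
  | zero =>
    have h := sum_prod_sub_div_nodeDiff hv (range r) (fun t => -(u - r + (t : ℂ))) (by simp)
    simp only [← risingFac_add_eq_prod_sub] at h
    simp [homSum, h, hstar]
  | succ k ihk =>
    induction r with
    | zero =>
      rw [hstar_succ_succ, ihk 0 μ hv, homSum_succ_of_injective hv, mshift_last]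
      simp [hstar]
    | succ r ihr =>
      have hshift : (fun j : Fin (r + 1) => mshift (r + 1 + 1) μ j.castSucc) =
          fun j => mshift (r + 1) (fun j => μ j.castSucc) j + 1 :=
        funext fun j => mshift_castSucc _ _ _
      have hv' : Function.Injective (mshift (r + 1) fun j => μ j.castSucc) := fun i j hij =>
        Fin.castSucc_injective _ (hv (by rw [mshift_castSucc, mshift_castSucc, hij]))
      rw [hstar_succ_succ, ihk (r + 1) μ hv, homSum_succ_of_injective hv, mshift_last,
        ihr _ hv', homSum, hshift]
      congr 1
      refine sum_congr rfl fun i _ => ?_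
      rw [nodeDiff_add_const, mshift_castSucc, show k + 1 + r = k + (r + 1) by omega]
      push_cast
      ring_nf

/-- The summand attached to the list of blocks of a composition. -/
noncomputable def blockTerm (p : ℕ → ℂ → ℂ) (u : ℂ) (L : List ℕ) : ℂ :=
  (1 / ∏ i ∈ range L.length, (((L.take (i + 1)).sum : ℕ) : ℂ)) *
    ∏ i ∈ range L.length, p (L.getD i 0) (u + (((L.take i).sum : ℕ) : ℂ))

theorem blockTerm_append_singleton (p : ℕ → ℂ → ℂ) (u : ℂ) (L : List ℕ) (a : ℕ) :
    blockTerm p u (L ++ [a]) =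
      blockTerm p u L * p a (u + (L.sum : ℕ)) / ((L.sum + a : ℕ) : ℂ) := by
  have htake : ∀ i ≤ L.length, (L ++ [a]).take i = L.take i := fun i hi =>
    List.take_append_of_le_length hi
  have h1 : ∏ i ∈ range L.length, ((((L ++ [a]).take (i + 1)).sum : ℕ) : ℂ) =
      ∏ i ∈ range L.length, (((L.take (i + 1)).sum : ℕ) : ℂ) :=
    prod_congr rfl fun i hi => by rw [htake _ (mem_range.1 hi)]
  have h2 : ∏ i ∈ range L.length,
      p ((L ++ [a]).getD i 0) (u + ((((L ++ [a]).take i).sum : ℕ) : ℂ)) =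
      ∏ i ∈ range L.length, p (L.getD i 0) (u + (((L.take i).sum : ℕ) : ℂ)) :=
    prod_congr rfl fun i hi => by
      rw [htake _ (mem_range.1 hi).le, List.getD_append _ _ _ _ (mem_range.1 hi)]
  have h3 : (L ++ [a]).take (L.length + 1) = L ++ [a] := List.take_of_length_le (by simp)
  rw [blockTerm, List.length_append, List.length_singleton, prod_range_succ, prod_range_succ,
    h1, h2, h3, htake _ le_rfl, List.take_length, blockTerm]
  simp only [List.sum_append, List.sum_singleton, List.getD_append_right, le_refl, Nat.sub_self,
    List.getD_cons_zero]
  rw [one_div, mul_inv, one_div]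
  ring

/-- Appending a last block to a composition. -/
def Composition.snocBlock {k : ℕ} (l : Fin k) (c : Composition l) : Composition k where
  blocks := c.blocks ++ [k - l]
  blocks_pos := by
    intro i hi
    rcases List.mem_append.1 hi with h | h
    · exact c.blocks_pos h
    · have := l.2
      rw [List.mem_singleton.1 h]
      omega
  blocks_sum := by
    have := l.2
    simp

theorem Composition.bijective_snocBlock (k : ℕ) (hk : 1 ≤ k) :
    Function.Bijective (fun x : (Σ l : Fin k, Composition l) => x.2.snocBlock x.1) := by
  constructor
  · rintro ⟨l, c⟩ ⟨l', c'⟩ h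
    have hb : c.blocks ++ [k - l] = c'.blocks ++ [k - l'] := congrArg Composition.blocks h
    have hb' := (List.append_inj' hb rfl).1
    obtain rfl : l = l' := Fin.ext (by rw [← c.blocks_sum, ← c'.blocks_sum, hb'])
    rw [Composition.ext hb']
  · intro c
    have hne : c.blocks ≠ [] := fun h => by
      have := c.blocks_sum
      simp [h] at this
      omega
    have hcat := List.dropLast_append_getLast hne
    have hpos := c.blocks_pos (List.getLast_mem hne)
    have hsum := c.blocks_sum
    rw [← hcat, List.sum_append, List.sum_singleton] at hsum
    refine ⟨⟨⟨c.blocks.dropLast.sum, by omega⟩, ⟨c.blocks.dropLast,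
      fun h => c.blocks_pos (List.mem_of_mem_dropLast h), rfl⟩⟩, Composition.ext ?_⟩
    simp only [snocBlock]
    rw [show k - c.blocks.dropLast.sum = c.blocks.getLast hne by omega, hcat]

theorem sum_blockTerm (p : ℕ → ℂ → ℂ) (u : ℂ) (k : ℕ) (hk : 1 ≤ k) :
    (k : ℂ) * ∑ c : Composition k, blockTerm p u c.blocks =
      ∑ l ∈ range k, (∑ c : Composition l, blockTerm p u c.blocks) * p (k - l) (u + l) := by
  have hk0 : (k : ℂ) ≠ 0 := by exact_mod_cast (by omega : k ≠ 0)
  rw [← (Composition.bijective_snocBlock k hk).sum_comp, Fintype.sum_sigma, mul_sum,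
    sum_range (fun l => (∑ c : Composition l, blockTerm p u c.blocks) * p (k - l) (u + l))]
  refine sum_congr rfl fun l _ => ?_
  rw [mul_sum, sum_mul]
  refine sum_congr rfl fun c _ => ?_
  have hl : (l : ℕ) + (k - l) = k := by omega
  simp only [Composition.snocBlock, blockTerm_append_singleton, Composition.blocks_sum, hl]
  field_simp

theorem blockTerm_blocks (p : ℕ → ℂ → ℂ) (u : ℂ) {k : ℕ} (c : Composition k) :
    blockTerm p u c.blocks =
      ((1 : ℂ) / ∏ i ∈ range c.length, ((c.sizeUpTo (i + 1) : ℕ) : ℂ)) *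
        ∏ i : Fin c.length, p (c.blocksFun i) (u + ((c.sizeUpTo (i : ℕ) : ℕ) : ℂ)) := by
  rw [blockTerm, prod_range (fun i => p (c.blocks.getD i 0) _)]
  congr 1
  refine prod_congr rfl fun i _ => ?_
  rw [List.getD_eq_getElem _ _ i.2]
  rfl

theorem homSum_eq_sum_blockTerm (r : ℕ) (μ : Fin (r + 1) → ℂ)
    (hv : Function.Injective (mshift (r + 1) μ)) (u : ℂ) (k : ℕ) :
    homSum (mshift (r + 1) μ) r k u =
      ∑ c : Composition k, blockTerm (pstar (r + 1) μ) u c.blocks := by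
  induction k using Nat.strong_induction_on with
  | _ k ih =>
    rcases Nat.eq_zero_or_pos k with rfl | hk
    · rw [← hstar_eq_homSum r μ hv]
      have hblocks : ∀ c : Composition 0, c.blocks = [] := fun c =>
        List.length_eq_zero_iff.1 (Nat.le_zero.1 c.length_le)
      simp only [hblocks]
      simp [hstar, blockTerm, composition_card]
    · have hk0 : (k : ℂ) ≠ 0 := by exact_mod_cast hk.ne'
      apply mul_left_cancel₀ hk0
      rw [sum_blockTerm _ _ _ hk, ← sum_homSum_mul hv r k (by simp)]
      refine sum_congr rfl fun l hl => ?_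
      rw [ih l (mem_range.1 hl)]
      simp only [pstar, gammaCoef, risingFac, add_assoc]

/-- If the `m_i` are pairwise distinct, then `h*_k(u+k−1)` equals the sum over all
compositions `λ = (λ_1,…,λ_m)` of `k` of
`(1/(a_1⋯a_m)) p*_{λ_1}(u) p*_{λ_2}(u+a_1) ⋯ p*_{λ_m}(u+a_{m−1})`,
where `a_i = λ_1 + ⋯ + λ_i` and `a_0 = 0`. -/
theorem hstar_eq_sum_compositions (n : ℕ) (hn : 1 ≤ n) (μ : Fin n → ℂ)
    (hdist : ∀ i j : Fin n, i ≠ j → mshift n μ i ≠ mshift n μ j)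
    (k : ℕ) (hk : 1 ≤ k) (u : ℂ) :
    hstar n μ k (u + (k : ℂ) - 1) =
      ∑ c : Composition k,
        ((1 : ℂ) / ∏ i ∈ Finset.range c.length, ((c.sizeUpTo (i + 1) : ℕ) : ℂ)) *
          ∏ i : Fin c.length,
            pstar n μ (c.blocksFun i) (u + ((c.sizeUpTo (i : ℕ) : ℕ) : ℂ)) := by
  obtain ⟨r, rfl⟩ : ∃ r, n = r + 1 := ⟨n - 1, by omega⟩
  have hv : Function.Injective (mshift (r + 1) μ) := fun i j h => by
    by_contra hij
    exact hdist i j hij h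
  rw [hstar_eq_homSum r μ hv, homSum_eq_sum_blockTerm r μ hv]
  exact sum_congr rfl fun c _ => blockTerm_blocks _ _ c
end
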